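/- arXiv:1401.1917 — 4 statements merged into one kernel-verified Lean document; each statement's English description precedes it below -/
import Mathlib

section
/- Let S = {x ∈ ℝⁿ : g₁(x) ≥ 0, …, g_m(x) ≥ 0} and suppose Assumption A holds. Then: (1) closure(conv(S)) ⊆ Ω_k(G̃) for every k ∈ ℕ and closure(conv(S)) = ⋂_{k=1}^∞ closure(Ω_k(G̃)); (2) if the PP-BDR property holds for S̃ with order k′, then closure(conv(S)) = closure(Ω_{k′}(G̃)); (3) for every fixed ε > 0 and r > 0 with closure(conv(S)) ∩ 𝐁_r ≠ ∅, there exists k_{r,ε} ∈ ℕ with closure(conv(S)) ∩ 𝐁_r ⊆ closure(Ω_{k_{r,ε}}(G̃)) ∩ 𝐁_r ⊆ (closure(conv(S)) + ε𝐁₁) ∩ 𝐁_r. -/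
open MvPolynomial Pointwise

/-- Homogenization of a polynomial in variables `X₁,…,Xₙ` (indexed by `Fin n`, shifted to
`X₁,…,Xₙ` via `Fin.succ`) with a new homogenizing variable `X₀`. -/
noncomputable def homog {n : ℕ} (f : MvPolynomial (Fin n) ℝ) : MvPolynomial (Fin (n + 1)) ℝ :=
  ∑ α ∈ f.support,
    MvPolynomial.monomial
      (Finsupp.mapDomain Fin.succ α + Finsupp.single 0 (f.totalDegree - α.sum fun _ e => e))
      (MvPolynomial.coeff α f)

/-- The `k`-th truncated quadratic module generated by the family `g`. -/
def QMod {τ ι : Type*} [Fintype ι] (k : ℕ) (g : ι → MvPolynomial τ ℝ) :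
    Set (MvPolynomial τ ℝ) :=
  {p | ∃ s₀ : MvPolynomial τ ℝ, ∃ s : ι → MvPolynomial τ ℝ,
      IsSumSq s₀ ∧ s₀.totalDegree ≤ 2 * k ∧
      (∀ i, IsSumSq (s i) ∧ (s i * g i).totalDegree ≤ 2 * k) ∧
      p = s₀ + ∑ i, s i * g i}

/-- The homogenized generating family `G̃`. -/
noncomputable def tGens {n : ℕ} {ι : Type*} (g : ι → MvPolynomial (Fin n) ℝ) :
    ι ⊕ Fin 3 → MvPolynomial (Fin (n + 1)) ℝ :=
  Sum.elim (fun j => homog (g j))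
    ![X 0, (∑ i, X i ^ 2) - 1, 1 - ∑ i, X i ^ 2]

/-- The modified theta body `TH̃ₖ(G̃)`. -/
noncomputable def thetaB {n : ℕ} {ι : Type*} [Fintype ι] (k : ℕ)
    (g : ι → MvPolynomial (Fin n) ℝ) : Set (Fin n → ℝ) :=
  {x | ∀ l ∈ QMod k (tGens g), l.IsHomogeneous 1 → 0 ≤ eval (Fin.cons 1 x) l}

/-- The Riesz functional of a truncated moment sequence. -/
noncomputable def riesz {m : ℕ} (y : (Fin m →₀ ℕ) → ℝ) (p : MvPolynomial (Fin m) ℝ) : ℝ :=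
  ∑ α ∈ p.support, MvPolynomial.coeff α p * y α

/-- The moment relaxation `Ωₖ(G̃)`. -/
noncomputable def omegaRel {n : ℕ} {ι : Type*} [Fintype ι] (k : ℕ)
    (g : ι → MvPolynomial (Fin n) ℝ) : Set (Fin n → ℝ) :=
  {x | ∃ y : (Fin (n + 1) →₀ ℕ) → ℝ,
      riesz y (X 0) = 1 ∧
      (∀ i : Fin n, riesz y (X i.succ) = x i) ∧
      (∀ q : MvPolynomial (Fin (n + 1)) ℝ, q.totalDegree ≤ k → 0 ≤ riesz y (q ^ 2)) ∧
      (∀ q : MvPolynomial (Fin (n + 1)) ℝ, q.totalDegree ≤ k - 1 → 0 ≤ riesz y (X 0 * q ^ 2)) ∧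
      (∀ q : MvPolynomial (Fin (n + 1)) ℝ, q.totalDegree ≤ 2 * (k - 1) →
        riesz y (((∑ i, X i ^ 2) - 1) * q) = 0) ∧
      (∀ j : ι, ∀ q : MvPolynomial (Fin (n + 1)) ℝ,
        q.totalDegree ≤ k - ((g j).totalDegree + 1) / 2 → 0 ≤ riesz y (homog (g j) * q ^ 2))}

/-- The basic semialgebraic set defined by the family `g`. -/
def semiS {n : ℕ} {ι : Type*} (g : ι → MvPolynomial (Fin n) ℝ) : Set (Fin n → ℝ) :=
  {x | ∀ j, 0 ≤ eval x (g j)}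

/-- `S̃ᵒ`. -/
noncomputable def StO {n : ℕ} {ι : Type*} (g : ι → MvPolynomial (Fin n) ℝ) :
    Set (Fin (n + 1) → ℝ) :=
  {x | (∀ j, 0 ≤ eval x (homog (g j))) ∧ 0 < x 0}

/-- `S̃ᶜ`. -/
noncomputable def StC {n : ℕ} {ι : Type*} (g : ι → MvPolynomial (Fin n) ℝ) :
    Set (Fin (n + 1) → ℝ) :=
  {x | (∀ j, 0 ≤ eval x (homog (g j))) ∧ 0 ≤ x 0}

/-- `S̃ = S̃ᶜ ∩ {‖x̃‖₂ = 1}`. -/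
noncomputable def StS {n : ℕ} {ι : Type*} (g : ι → MvPolynomial (Fin n) ℝ) :
    Set (Fin (n + 1) → ℝ) :=
  {x | (∀ j, 0 ≤ eval x (homog (g j))) ∧ 0 ≤ x 0 ∧ ∑ i, x i ^ 2 = 1}

/-- Assumption A: `S` is closed at infinity, and `conv(closure(S̃ᵒ))` is closed and pointed. -/
noncomputable def AssumpA {n : ℕ} {ι : Type*} (g : ι → MvPolynomial (Fin n) ℝ) : Prop :=
  closure (StO g) = StC g ∧ IsClosed (convexHull ℝ (closure (StO g))) ∧
    convexHull ℝ (closure (StO g)) ∩ -(convexHull ℝ (closure (StO g))) = {0}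

/-- The PP-BDR property with order `k` for the set `T ⊆ ℝⁿ⁺¹` relative to the homogenized
generating family `tGens g`: outside a Lebesgue-null set of coefficient vectors, every affine
polynomial positive on `T` lies in the `k`-th truncated quadratic module of `G̃`. -/
noncomputable def ppBDR {n : ℕ} {ι : Type*} [Fintype ι] (k : ℕ)
    (g : ι → MvPolynomial (Fin n) ℝ) (T : Set (Fin (n + 1) → ℝ)) : Prop :=
  MeasureTheory.volume {c : Fin (n + 2) → ℝ |
    (∀ x ∈ T, 0 < c 0 + ∑ i : Fin (n + 1), c i.succ * x i) ∧
    (C (c 0) + ∑ i : Fin (n + 1), C (c i.succ) * X i) ∉ QMod k (tGens g)} = 0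


/-- States of the cone `Q`. -/
def statesOf {A : Type*} [CommRing A] [Algebra ℝ A] (Q : Set A) : Set (A → ℝ) :=
  {φ | (∀ a b, φ (a + b) = φ a + φ b) ∧ (∀ (r : ℝ) a, φ (r • a) = r * φ a) ∧
    (∀ a ∈ Q, 0 ≤ φ a) ∧ φ 1 = 1}

theorem exists_state {A : Type*} [CommRing A] [Algebra ℝ A] (Q : Set A)
    (hQadd : ∀ a ∈ Q, ∀ b ∈ Q, a + b ∈ Q) (hQsmul : ∀ r : ℝ, 0 ≤ r → ∀ a ∈ Q, r • a ∈ Q)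
    (hQone : (1 : A) ∈ Q)
    (harch : ∀ f : A, ∃ N : ℝ, N • (1 : A) + f ∈ Q)
    (l : A) (hl : l ∉ Q) : ∃ φ ∈ statesOf Q, φ l ≤ 0 := by
  have h10 : (1 : A) ≠ 0 := by
    intro h
    apply hl
    have : l = 1 := by rw [← mul_one l, h, mul_zero]
    rw [this]; exact hQone
  have h0 : (0 : A) ∈ Q := by simpa using hQsmul 0 le_rfl 1 hQone
  let s : PointedCone ℝ A :=
    { carrier := {a | ∃ q ∈ Q, ∃ t : ℝ, 0 ≤ t ∧ a = q - t • l}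
      zero_mem' := ⟨0, h0, 0, le_rfl, by simp⟩
      add_mem' := by
        rintro a b ⟨q, hq, t, ht, rfl⟩ ⟨q', hq', t', ht', rfl⟩
        exact ⟨q + q', hQadd _ hq _ hq', t + t', by positivity, by module⟩
      smul_mem' := by
        rintro ⟨c, hc⟩ a ⟨q, hq, t, ht, rfl⟩
        refine ⟨c • q, hQsmul c hc q hq, c * t, by positivity, ?_⟩
        change c • (q - t • l) = _
        module }
  have hs : ∀ a, a ∈ s ↔ ∃ q ∈ Q, ∃ t : ℝ, 0 ≤ t ∧ a = q - t • l := fun a => Iff.rfl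
  let f : A →ₗ.[ℝ] ℝ := LinearPMap.mkSpanSingleton (1 : A) (1 : ℝ) h10
  have hf : ∀ (c : ℝ) (h : c • (1 : A) ∈ f.domain), f ⟨c • 1, h⟩ = c := by
    intro c h
    have := LinearPMap.mkSpanSingleton'_apply (σ := RingHom.id ℝ) (1 : A) (1 : ℝ)
      (by intro c hc; rcases smul_eq_zero.1 hc with h | h
          · simp [h]
          · exact absurd h h10) c h
    simp only [RingHom.id_apply, smul_eq_mul, mul_one] at this
    exact this
  have hdom : ∀ c : ℝ, c • (1 : A) ∈ f.domain := fun c =>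
    Submodule.mem_span_singleton.2 ⟨c, rfl⟩
  obtain ⟨G, hG1, hG2⟩ := riesz_extension s f (by
    rintro ⟨x, hx⟩ hxs
    obtain ⟨c, rfl⟩ := Submodule.mem_span_singleton.1 hx
    rw [hf]
    by_contra hc
    push Not at hc
    obtain ⟨q, hq, t, ht, h⟩ := (hs _).1 hxs
    change c • (1 : A) = _ at h
    apply hl
    rcases ht.eq_or_lt with rfl | ht
    · have hn : c • (1 : A) ∈ Q := by
        rw [h]; simpa using hq
      obtain ⟨N, hN⟩ := harch l
      have : l = (N • (1 : A) + l) + (if 0 ≤ N then (N / (-c)) • (c • (1 : A)) else (-N) • (1 : A)) := by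
        split_ifs with h
        · rw [smul_smul]
          have : N / -c * c = -N := by
            rw [div_neg, neg_mul, div_mul_cancel₀ _ hc.ne]
          rw [this]; module
        · module
      rw [this]
      refine hQadd _ hN _ ?_
      split_ifs with h
      · exact hQsmul _ (div_nonneg h (by linarith)) _ hn
      · exact hQsmul _ (by linarith) _ hQone
    · have : l = t⁻¹ • (q + (-c) • (1 : A)) := by
        have : t • l = q + (-c) • (1 : A) := by
          rw [neg_smul, h]; abel
        rw [← this, smul_smul, inv_mul_cancel₀ ht.ne', one_smul]
      rw [this]
      exact hQsmul _ (by positivity) _ (hQadd _ hq _ (hQsmul _ (by linarith) _ hQone)))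
    (by
      intro y
      obtain ⟨N, hN⟩ := harch y
      exact ⟨⟨N • 1, hdom N⟩, (hs _).2 ⟨_, hN, 0, le_rfl, by simp⟩⟩)
  refine ⟨G, ⟨fun a b => map_add G a b, fun r a => by simp, fun a ha => ?_, ?_⟩, ?_⟩
  · exact hG2 a ((hs _).2 ⟨a, ha, 0, le_rfl, by simp⟩)
  · have := hG1 ⟨(1 : ℝ) • (1 : A), hdom 1⟩
    rw [hf] at this
    simpa using this
  · have := hG2 (-l) ((hs _).2 ⟨0, h0, 1, by simp, by simp⟩)
    simpa using this

theorem states_compact {A : Type*} [CommRing A] [Algebra ℝ A] (Q : Set A)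
    (harch : ∀ f : A, ∃ N : ℝ, N • (1 : A) + f ∈ Q) : IsCompact (statesOf Q) := by
  choose N hN using harch
  have hsub : statesOf Q ⊆ Set.univ.pi fun f => Set.Icc (-N f) (N (-f)) := by
    rintro φ ⟨h1, h2, h3, h4⟩ f -
    have a := h3 _ (hN f)
    have b := h3 _ (hN (-f))
    have hneg : φ (-f) = - φ f := by
      have := h2 (-1) f
      simpa using this
    rw [h1, h2, h4] at a b
    rw [hneg] at b
    constructor <;> linarith
  refine (isCompact_univ_pi fun f => isCompact_Icc).of_isClosed_subset ?_ hsub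
  have : statesOf Q = (⋂ a, ⋂ b, {φ : A → ℝ | φ (a + b) = φ a + φ b}) ∩
      ((⋂ r : ℝ, ⋂ a, {φ : A → ℝ | φ (r • a) = r * φ a}) ∩
      ((⋂ a ∈ Q, {φ : A → ℝ | 0 ≤ φ a}) ∩ {φ : A → ℝ | φ 1 = 1})) := by
    ext φ; simp [statesOf]
  rw [this]
  refine IsClosed.inter ?_ (IsClosed.inter ?_ (IsClosed.inter ?_ ?_))
  · exact isClosed_iInter fun a => isClosed_iInter fun b =>
      isClosed_eq (by fun_prop) (by fun_prop)
  · exact isClosed_iInter fun a => isClosed_iInter fun b =>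
      isClosed_eq (by fun_prop) (by fun_prop)
  · exact isClosed_iInter fun a => isClosed_iInter fun b =>
      isClosed_le (by fun_prop) (by fun_prop)
  · exact isClosed_eq (by fun_prop) (by fun_prop)

theorem extreme_mul {A : Type*} [CommRing A] [Algebra ℝ A] (Q : Set A)
    (harch : ∀ f : A, ∃ N : ℝ, N • (1 : A) + f ∈ Q) (hQone : (1 : A) ∈ Q)
    (φ : A → ℝ) (hφ : φ ∈ Set.extremePoints ℝ (statesOf Q))
    (a : A) (ha : ∀ f ∈ Q, a * f ∈ Q) (ha' : ∀ f ∈ Q, (1 - a) * f ∈ Q) (f : A) :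
    φ (a * f) = φ a * φ f := by
  rw [mem_extremePoints_iff_left] at hφ
  obtain ⟨⟨h1, h2, h3, h4⟩, hext⟩ := hφ
  have hneg : ∀ f, φ (-f) = - φ f := by
    intro f
    have := h2 (-1) f
    simpa using this
  have hzero : ∀ b, (∀ f ∈ Q, b * f ∈ Q) → φ b = 0 → ∀ f, φ (b * f) = 0 := by
    intro b hb hb0 f
    obtain ⟨N, hN⟩ := harch f
    obtain ⟨M, hM⟩ := harch (-f)
    have x := h3 _ (hb _ hN)
    have y := h3 _ (hb _ hM)
    rw [mul_add, mul_smul_comm, mul_one, h1, h2, hb0] at x y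
    rw [mul_neg, hneg] at y
    linarith
  have hsub : ∀ f, φ ((1 - a) * f) = φ f - φ (a * f) := by
    intro f
    rw [sub_mul, one_mul, sub_eq_add_neg, h1, hneg]; ring
  have ht0 : 0 ≤ φ a := by simpa using h3 _ (ha 1 hQone)
  have ht1' : φ (1 - a) = 1 - φ a := by simpa [h4] using hsub 1
  have ht1 : 0 ≤ 1 - φ a := by rw [← ht1']; simpa using h3 _ (ha' 1 hQone)
  rcases ht0.eq_or_lt with h | h
  · rw [hzero a ha h.symm, ← h, zero_mul]
  rcases ht1.eq_or_lt with h' | h'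
  · have := hzero (1 - a) ha' (by rw [ht1', ← h']) f
    rw [hsub] at this
    have e : φ a = 1 := by linarith
    rw [e]; linarith
  have key := hext (fun f => (φ a)⁻¹ * φ (a * f)) ⟨fun x y => by simp only [mul_add, h1],
    fun r x => by simp only [mul_smul_comm, h2]; ring,
    fun x hx => mul_nonneg (by positivity) (h3 _ (ha x hx)),
    by beta_reduce; rw [mul_one]; exact inv_mul_cancel₀ h.ne'⟩
    (fun f => (1 - φ a)⁻¹ * φ ((1 - a) * f)) ⟨fun x y => by simp only [mul_add, h1],
    fun r x => by simp only [mul_smul_comm, h2]; ring,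
    fun x hx => mul_nonneg (by positivity) (h3 _ (ha' x hx)),
    by beta_reduce; rw [mul_one, ht1']; exact inv_mul_cancel₀ h'.ne'⟩
    ⟨φ a, 1 - φ a, h, h', by ring, by
      ext x
      simp only [Pi.add_apply, Pi.smul_apply, smul_eq_mul]
      rw [mul_inv_cancel_left₀ h.ne', mul_inv_cancel_left₀ h'.ne', hsub]; ring⟩
  have := congrFun key f
  rw [← this, mul_inv_cancel_left₀ h.ne']

theorem exists_char {A : Type*} [CommRing A] [Algebra ℝ A] (P Q : Set A)
    (hPQ : ∀ a ∈ P, ∀ f ∈ Q, a * f ∈ Q) (hPsub : P ⊆ Q)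
    (hPsmul : ∀ r : ℝ, 0 ≤ r → ∀ a ∈ P, r • a ∈ P)
    (hQadd : ∀ a ∈ Q, ∀ b ∈ Q, a + b ∈ Q) (hQsmul : ∀ r : ℝ, 0 ≤ r → ∀ a ∈ Q, r • a ∈ Q)
    (hQone : (1 : A) ∈ Q)
    (harch : ∀ f : A, ∃ N : ℝ, 0 < N ∧ N • (1 : A) + f ∈ P ∧ N • (1 : A) - f ∈ P)
    (l : A) (hl : l ∉ Q) : ∃ φ : A →ₐ[ℝ] ℝ, (∀ f ∈ Q, 0 ≤ φ f) ∧ φ l ≤ 0 := by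
  have harch' : ∀ f : A, ∃ N : ℝ, N • (1 : A) + f ∈ Q := fun f => by
    obtain ⟨N, -, h, -⟩ := harch f
    exact ⟨N, hPsub h⟩
  obtain ⟨φ₀, hφ₀, hφ₀l⟩ := exists_state Q hQadd hQsmul hQone harch' l hl
  have hcomp := states_compact Q harch'
  obtain ⟨ψ, hψ, hmin⟩ := hcomp.exists_isMinOn ⟨φ₀, hφ₀⟩
    (f := fun φ : A → ℝ => φ l) (by fun_prop)
  have hψl : ψ l ≤ 0 := (hmin hφ₀).trans hφ₀l
  let F : Set (A → ℝ) := statesOf Q ∩ {φ | φ l ≤ ψ l}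
  have hFc : IsCompact F := hcomp.inter_right (isClosed_le (by fun_prop) (by fun_prop))
  obtain ⟨φ, hφ⟩ := hFc.extremePoints_nonempty ⟨ψ, hψ, le_refl (ψ l)⟩
  have hFe : IsExtreme ℝ (statesOf Q) F := by
    refine ⟨Set.inter_subset_left, ?_⟩
    rintro x hx y hy z ⟨hz, hzl⟩ ⟨a, b, ha, hb, hab, rfl⟩
    refine ⟨hx, ?_⟩
    have h2 : ψ l ≤ y l := hmin hy
    simp only [Set.mem_ofPred_eq, Pi.add_apply, Pi.smul_apply, smul_eq_mul] at hzl ⊢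
    by_contra hc
    push Not at hc
    have e : ψ l = a * ψ l + b * ψ l := by rw [← add_mul, hab, one_mul]
    have := mul_lt_mul_of_pos_left hc ha
    have := mul_le_mul_of_nonneg_left h2 hb.le
    linarith
  have hφe := hFe.extremePoints_subset_extremePoints hφ
  have hφF : φ ∈ F := extremePoints_subset hφ
  obtain ⟨⟨h1, h2, h3, h4⟩, h5⟩ := hφF
  have hmul : ∀ f g, φ (f * g) = φ f * φ g := by
    intro f g
    obtain ⟨N, hN0, hN1, hN2⟩ := harch f
    have key := extreme_mul Q harch' hQone φ hφe ((2 * N)⁻¹ • (N • (1 : A) + f))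
      (hPQ _ (hPsmul _ (by positivity) _ hN1)) (by
        have : 1 - (2 * N)⁻¹ • (N • (1 : A) + f) = (2 * N)⁻¹ • (N • (1 : A) - f) := by
          have : (1 : A) = (2 * N)⁻¹ • ((2 * N) • (1 : A)) := by
            rw [smul_smul, inv_mul_cancel₀ (by positivity), one_smul]
          nth_rewrite 1 [this]
          module
        rw [this]
        exact hPQ _ (hPsmul _ (by positivity) _ hN2)) g
    rw [smul_mul_assoc, add_mul, smul_mul_assoc, one_mul] at key
    simp only [h1, h2, h4] at key
    have h : (2 * N)⁻¹ ≠ 0 := by positivity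
    have key' : (2 * N)⁻¹ * (N * φ g + φ (f * g)) = (2 * N)⁻¹ * ((N * 1 + φ f) * φ g) := by
      rw [key]; ring
    have := mul_left_cancel₀ h key'
    linarith
  have hz : φ 0 = 0 := by simpa using h2 0 0
  let Φ : A →ₐ[ℝ] ℝ := AlgHom.mk
    { toFun := φ, map_one' := h4, map_mul' := hmul, map_zero' := hz, map_add' := h1 }
    (by intro r; simp [Algebra.algebraMap_eq_smul_one, h2, h4])
  exact ⟨Φ, h3, le_trans h5 hψl⟩

theorem sumSq_repr {A : Type*} [CommRing A] {s : A} (hs : IsSumSq s) :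
    ∃ (N : ℕ) (q : Fin N → A), s = ∑ i, q i * q i := by
  induction hs with
  | zero => exact ⟨0, Fin.elim0, by simp⟩
  | sq_add a hs ih =>
    obtain ⟨N, q, rfl⟩ := ih
    exact ⟨N + 1, Fin.cons a q, by simp [Fin.sum_univ_succ]⟩

theorem deg_le_pred {τ : Type*} (q : MvPolynomial τ ℝ) (D : ℕ) (hD : 0 < D)
    (hq : q.totalDegree ≤ D) (h0 : homogeneousComponent D q = 0) : q.totalDegree ≤ D - 1 := by
  unfold totalDegree
  apply Finset.sup_le
  intro α hα
  have h1 : (α.sum fun _ e => e) ≤ D := (le_totalDegree hα).trans hq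
  have h2 : (α.sum fun _ e => e) ≠ D := by
    intro h
    have := congrArg (coeff α) h0
    rw [coeff_homogeneousComponent, if_pos (show α.degree = D from h)] at this
    exact (mem_support_iff.1 hα) (by simpa using this)
  omega

theorem hc_sq {τ : Type*} (q : MvPolynomial τ ℝ) (D : ℕ) (hD : 0 < D)
    (hq : q.totalDegree ≤ D) :
    homogeneousComponent (2 * D) (q * q) =
      homogeneousComponent D q * homogeneousComponent D q := by
  set h := homogeneousComponent D q with hh
  have hr : (q - h).totalDegree ≤ D - 1 := by
    apply deg_le_pred _ _ hD
    · exact (totalDegree_sub _ _).trans (max_le hq (homogeneousComponent_isHomogeneous D q).totalDegree_le)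
    · rw [map_sub, homogeneousComponent_eq_self (homogeneousComponent_isHomogeneous D q), sub_self]
  have e : q * q = h * h + (2 * h + (q - h)) * (q - h) := by ring
  have hhom : h.IsHomogeneous D := homogeneousComponent_isHomogeneous D q
  rw [e, map_add, homogeneousComponent_eq_zero (2 * D) ((2 * h + (q - h)) * (q - h)), add_zero]
  · apply homogeneousComponent_eq_self
    have := hhom.mul hhom
    rwa [← two_mul] at this
  · refine lt_of_le_of_lt (totalDegree_mul _ _) ?_
    have : (2 * h + (q - h)).totalDegree ≤ D := by
      have e : 2 * h + (q - h) = h + q := by ring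
      rw [e]
      exact (totalDegree_add _ _).trans (max_le hhom.totalDegree_le hq)
    omega

theorem sumSq_degree {τ : Type*} {N : ℕ} (q : Fin N → MvPolynomial τ ℝ) (k : ℕ)
    (h : (∑ i, q i * q i).totalDegree ≤ 2 * k + 1) : ∀ i, (q i).totalDegree ≤ k := by
  have key : ∀ j, (∀ i, (q i).totalDegree ≤ k + j) → ∀ i, (q i).totalDegree ≤ k := by
    intro j
    induction j with
    | zero => intro h; exact h
    | succ j ih =>
      intro hj
      apply ih
      have h0 : homogeneousComponent (2 * (k + (j + 1))) (∑ i, q i * q i) = 0 :=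
        homogeneousComponent_eq_zero _ _ (by omega)
      rw [map_sum] at h0
      simp_rw [fun i => hc_sq (q i) (k + (j + 1)) (by omega) (hj i)] at h0
      intro i
      have hz : homogeneousComponent (k + (j + 1)) (q i) = 0 := by
        apply MvPolynomial.funext
        intro x
        have := congrArg (eval x) h0
        rw [map_sum, map_zero, Finset.sum_eq_zero_iff_of_nonneg] at this
        · have := this i (Finset.mem_univ i)
          rw [map_mul, mul_self_eq_zero] at this
          simpa using this
        · intro i _
          rw [map_mul]; exact mul_self_nonneg _
      have := deg_le_pred _ _ (by omega) (hj i) hz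
      omega
  obtain ⟨j, hj⟩ : ∃ j, ∀ i, (q i).totalDegree ≤ j :=
    ⟨Finset.univ.sup fun i => (q i).totalDegree, fun i =>
      Finset.le_sup (f := fun i => (q i).totalDegree) (Finset.mem_univ i)⟩
  exact key j fun i => (hj i).trans (by omega)

theorem homog_isHom {n : ℕ} (f : MvPolynomial (Fin n) ℝ) :
    (homog f).IsHomogeneous f.totalDegree := by
  unfold homog
  apply IsHomogeneous.sum
  intro α hα
  apply isHomogeneous_monomial
  have h := le_totalDegree hα
  rw [map_add, Finsupp.degree_single, Finsupp.degree_mapDomain]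
  have e : α.degree = α.sum fun _ e => e := rfl
  omega

theorem eval_homog {n : ℕ} (f : MvPolynomial (Fin n) ℝ) (x : Fin n → ℝ) :
    eval (Fin.cons 1 x) (homog f) = eval x f := by
  unfold homog
  rw [map_sum, eval_eq]
  refine Finset.sum_congr rfl fun α _ => ?_
  rw [eval_monomial, Finsupp.prod_add_index' (by simp) (by intros; rw [pow_add]),
    Finsupp.prod_mapDomain_index_inj (Fin.succ_injective _), Finsupp.prod_single_index (by simp)]
  simp [Finsupp.prod]

theorem homog_ne_zero {n : ℕ} (f : MvPolynomial (Fin n) ℝ) (hf : f ≠ 0) : homog f ≠ 0 := by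
  intro h
  apply hf
  apply MvPolynomial.funext
  intro x
  rw [← eval_homog, h]; simp

theorem eval_homog_smul {n : ℕ} (f : MvPolynomial (Fin n) ℝ) (t : ℝ) (x : Fin (n + 1) → ℝ) :
    eval (t • x) (homog f) = t ^ f.totalDegree * eval x (homog f) := by
  have h := homog_isHom f
  rw [eval_eq, eval_eq, Finset.mul_sum]
  refine Finset.sum_congr rfl fun α hα => ?_
  have : ∏ i ∈ α.support, t ^ α i = t ^ f.totalDegree := by
    rw [Finset.prod_pow_eq_pow_sum, h.degree_eq_sum_deg_support hα]
  simp only [Pi.smul_apply, smul_eq_mul, mul_pow, Finset.prod_mul_distrib, this]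
  ring

theorem riesz_eq {m : ℕ} (y : (Fin m →₀ ℕ) → ℝ) (p : MvPolynomial (Fin m) ℝ) :
    riesz y p = (basisMonomials (Fin m) ℝ).constr ℝ y p := by
  conv_rhs => rw [← support_sum_monomial_coeff p]
  rw [map_sum]
  unfold riesz
  refine Finset.sum_congr rfl fun α _ => ?_
  have : monomial α (coeff α p) = (coeff α p) • basisMonomials (Fin m) ℝ α := by
    simp [smul_monomial]
  rw [this, map_smul, Module.Basis.constr_basis, smul_eq_mul]

theorem riesz_add {m : ℕ} (y : (Fin m →₀ ℕ) → ℝ) (p q : MvPolynomial (Fin m) ℝ) :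
    riesz y (p + q) = riesz y p + riesz y q := by
  simp only [riesz_eq, map_add]

theorem riesz_smul {m : ℕ} (y : (Fin m →₀ ℕ) → ℝ) (c : ℝ) (p : MvPolynomial (Fin m) ℝ) :
    riesz y (c • p) = c * riesz y p := by
  simp only [riesz_eq, map_smul, smul_eq_mul]

theorem riesz_sum {m : ℕ} {ι : Type*} (s : Finset ι) (y : (Fin m →₀ ℕ) → ℝ)
    (p : ι → MvPolynomial (Fin m) ℝ) :
    riesz y (∑ i ∈ s, p i) = ∑ i ∈ s, riesz y (p i) := by
  simp only [riesz_eq, map_sum]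

theorem riesz_comb {m : ℕ} (y z : (Fin m →₀ ℕ) → ℝ) (a b : ℝ) (p : MvPolynomial (Fin m) ℝ) :
    riesz (a • y + b • z) p = a * riesz y p + b * riesz z p := by
  unfold riesz
  rw [Finset.mul_sum, Finset.mul_sum, ← Finset.sum_add_distrib]
  refine Finset.sum_congr rfl fun α _ => ?_
  simp; ring

theorem riesz_point {m : ℕ} (r : ℝ) (v : Fin m → ℝ) (p : MvPolynomial (Fin m) ℝ) :
    riesz (fun α => r * ∏ i ∈ α.support, v i ^ α i) p = r * eval v p := by
  unfold riesz
  rw [eval_eq, Finset.mul_sum]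
  refine Finset.sum_congr rfl fun α _ => ?_
  ring

theorem isSumSq_smul {A : Type*} [CommRing A] [Algebra ℝ A] {s : A} (hs : IsSumSq s) (r : ℝ)
    (hr : 0 ≤ r) : IsSumSq (r • s) := by
  have : r • s = (algebraMap ℝ A (Real.sqrt r) * algebraMap ℝ A (Real.sqrt r)) * s := by
    rw [← map_mul, Real.mul_self_sqrt hr, Algebra.smul_def]
  rw [this]
  exact (IsSumSq.mul_self _).mul hs

/-- The sphere polynomial. -/
noncomputable def sphP (n : ℕ) : MvPolynomial (Fin (n + 1)) ℝ := (∑ i, X i ^ 2) - 1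

/-- Sums of squares modulo the sphere ideal. -/
def sphPre (n : ℕ) : Set (MvPolynomial (Fin (n + 1)) ℝ) :=
  {a | ∃ s h, IsSumSq s ∧ a = s + sphP n * h}

theorem sphPre_add {n : ℕ} {a b : MvPolynomial (Fin (n + 1)) ℝ} (ha : a ∈ sphPre n)
    (hb : b ∈ sphPre n) : a + b ∈ sphPre n := by
  obtain ⟨s, h, hs, rfl⟩ := ha
  obtain ⟨s', h', hs', rfl⟩ := hb
  exact ⟨s + s', h + h', hs.add hs', by ring⟩

theorem sphPre_mul {n : ℕ} {a b : MvPolynomial (Fin (n + 1)) ℝ} (ha : a ∈ sphPre n)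
    (hb : b ∈ sphPre n) : a * b ∈ sphPre n := by
  obtain ⟨s, h, hs, rfl⟩ := ha
  obtain ⟨s', h', hs', rfl⟩ := hb
  exact ⟨s * s', h * s' + s * h' + sphP n * h * h', hs.mul hs', by ring⟩

theorem sphPre_smul {n : ℕ} {a : MvPolynomial (Fin (n + 1)) ℝ} (r : ℝ) (hr : 0 ≤ r)
    (ha : a ∈ sphPre n) : r • a ∈ sphPre n := by
  obtain ⟨s, h, hs, rfl⟩ := ha
  exact ⟨r • s, r • h, isSumSq_smul hs r hr, by rw [smul_add, mul_smul_comm]⟩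

theorem sphPre_sumSq {n : ℕ} {a : MvPolynomial (Fin (n + 1)) ℝ} (ha : IsSumSq a) :
    a ∈ sphPre n := ⟨a, 0, ha, by simp⟩

theorem sphPre_X {n : ℕ} (i : Fin (n + 1)) (e : MvPolynomial (Fin (n + 1)) ℝ) (he : e * e = 1) :
    (1 : ℝ) • 1 + e * X i ∈ sphPre n := by
  refine ⟨(1 / 2 : ℝ) • ((1 + e * X i) * (1 + e * X i) + ∑ j ∈ Finset.univ.erase i, X j ^ 2),
    (-(1 / 2) : ℝ) • 1, ?_, ?_⟩
  · refine isSumSq_smul (IsSumSq.add (IsSumSq.mul_self _) ?_) _ (by norm_num)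
    exact IsSumSq.sum_sq _ _
  · have h1 : ∑ j ∈ Finset.univ.erase i, (X j : MvPolynomial (Fin (n + 1)) ℝ) ^ 2
        = sphP n + 1 - X i ^ 2 := by
      have := Finset.add_sum_erase Finset.univ
        (fun j => (X j : MvPolynomial (Fin (n + 1)) ℝ) ^ 2) (Finset.mem_univ i)
      unfold sphP
      rw [← this]
      ring
    rw [h1, mul_smul_comm, neg_smul, mul_one]
    have h2 : (1 + e * X i) * (1 + e * X i) = 1 + (2 : ℝ) • (e * X i) + X i ^ 2 := by
      rw [show (2 : ℝ) • (e * X i) = 2 * (e * X i) by rw [two_smul, two_mul]]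
      linear_combination (X i ^ 2) * he
    rw [h2]
    module

theorem sphPre_arch {n : ℕ} (f : MvPolynomial (Fin (n + 1)) ℝ) :
    ∃ N : ℝ, 0 < N ∧ N • 1 + f ∈ sphPre n ∧ N • 1 - f ∈ sphPre n := by
  have hone : (1 : MvPolynomial (Fin (n + 1)) ℝ) ∈ sphPre n := sphPre_sumSq IsSumSq.one
  induction f using MvPolynomial.induction_on with
  | C r =>
    have e : (C r : MvPolynomial (Fin (n + 1)) ℝ) = r • 1 := by
      rw [smul_eq_C_mul, mul_one]
    refine ⟨|r| + 1, by positivity, ?_, ?_⟩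
    · rw [e, ← add_smul]
      exact sphPre_smul _ (by linarith [neg_abs_le r]) hone
    · rw [e, ← sub_smul]
      exact sphPre_smul _ (by linarith [le_abs_self r]) hone
  | add p q hp hq =>
    obtain ⟨N, hN, h1, h2⟩ := hp
    obtain ⟨M, hM, h3, h4⟩ := hq
    refine ⟨N + M, by positivity, ?_, ?_⟩
    · convert sphPre_add h1 h3 using 1
      module
    · convert sphPre_add h2 h4 using 1
      module
  | mul_X p i hp =>
    obtain ⟨N, hN, h1, h2⟩ := hp
    have h3 := sphPre_X i 1 (by ring)
    have h4 := sphPre_X i (-1) (by ring)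
    refine ⟨N, hN, ?_, ?_⟩
    · convert sphPre_smul (1 / 2) (by norm_num) (sphPre_add (sphPre_mul h1 h3) (sphPre_mul h2 h4))
        using 1
      simp only [smul_eq_C_mul]
      have : (C (1 / 2) : MvPolynomial (Fin (n + 1)) ℝ) * 2 = 1 := by
        rw [show (2 : MvPolynomial (Fin (n + 1)) ℝ) = C 2 from rfl, ← C_mul]; norm_num
      rw [C_1]
      linear_combination (-(C N + p * X i)) * this
    · convert sphPre_smul (1 / 2) (by norm_num) (sphPre_add (sphPre_mul h1 h4) (sphPre_mul h2 h3))
        using 1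
      simp only [smul_eq_C_mul]
      have : (C (1 / 2) : MvPolynomial (Fin (n + 1)) ℝ) * 2 = 1 := by
        rw [show (2 : MvPolynomial (Fin (n + 1)) ℝ) = C 2 from rfl, ← C_mul]; norm_num
      rw [C_1]
      linear_combination (-(C N - p * X i)) * this

/-- The full quadratic module. -/
def fullQ {τ ι : Type*} [Fintype ι] (g : ι → MvPolynomial τ ℝ) : Set (MvPolynomial τ ℝ) :=
  {p | ∃ s₀ : MvPolynomial τ ℝ, ∃ s : ι → MvPolynomial τ ℝ,
      IsSumSq s₀ ∧ (∀ i, IsSumSq (s i)) ∧ p = s₀ + ∑ i, s i * g i}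

theorem fullQ_add {τ ι : Type*} [Fintype ι] {g : ι → MvPolynomial τ ℝ} {a b : MvPolynomial τ ℝ}
    (ha : a ∈ fullQ g) (hb : b ∈ fullQ g) : a + b ∈ fullQ g := by
  obtain ⟨s, h, hs, hh, rfl⟩ := ha
  obtain ⟨s', h', hs', hh', rfl⟩ := hb
  refine ⟨s + s', h + h', hs.add hs', fun i => (hh i).add (hh' i), ?_⟩
  simp only [Pi.add_apply, add_mul, Finset.sum_add_distrib]
  abel

theorem fullQ_mul {τ ι : Type*} [Fintype ι] {g : ι → MvPolynomial τ ℝ} {a b : MvPolynomial τ ℝ}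
    (ha : IsSumSq a) (hb : b ∈ fullQ g) : a * b ∈ fullQ g := by
  obtain ⟨s, h, hs, hh, rfl⟩ := hb
  refine ⟨a * s, fun i => a * h i, ha.mul hs, fun i => ha.mul (hh i), ?_⟩
  rw [mul_add, Finset.mul_sum]
  simp only [mul_assoc]

theorem fullQ_sumSq {τ ι : Type*} [Fintype ι] {g : ι → MvPolynomial τ ℝ} {a : MvPolynomial τ ℝ}
    (ha : IsSumSq a) : a ∈ fullQ g :=
  ⟨a, 0, ha, fun _ => IsSumSq.zero, by simp⟩

theorem fullQ_gen {τ ι : Type*} [Fintype ι] {g : ι → MvPolynomial τ ℝ} (i : ι) :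
    g i ∈ fullQ g := by
  classical
  refine ⟨0, Pi.single i 1, IsSumSq.zero, fun j => ?_, ?_⟩
  · by_cases h : j = i
    · subst h; simp
    · simp [h]
  · simp [Pi.single_apply]

theorem fullQ_QMod {τ ι : Type*} [Fintype ι] {g : ι → MvPolynomial τ ℝ} {p : MvPolynomial τ ℝ}
    (hp : p ∈ fullQ g) : ∃ k, p ∈ QMod k g := by
  obtain ⟨s, h, hs, hh, rfl⟩ := hp
  refine ⟨s.totalDegree + ∑ i, (h i * g i).totalDegree, s, h, hs, by omega,
    fun i => ⟨hh i, ?_⟩, rfl⟩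
  have := Finset.single_le_sum (f := fun i => (h i * g i).totalDegree) (fun _ _ => Nat.zero_le _)
    (Finset.mem_univ i)
  omega

theorem fullQ_ideal {n m : ℕ} (g : Fin m → MvPolynomial (Fin n) ℝ)
    (h : MvPolynomial (Fin (n + 1)) ℝ) : sphP n * h ∈ fullQ (tGens g) := by
  have h1 : sphP n ∈ fullQ (tGens g) := by
    have := fullQ_gen (g := tGens g) (Sum.inr 1)
    exact this
  have h2 : -sphP n ∈ fullQ (tGens g) := by
    have := fullQ_gen (g := tGens g) (Sum.inr 2)
    convert this using 1
    simp [tGens, sphP]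
  have e : sphP n * h = ((C (1 / 2) * (h + 1)) * (C (1 / 2) * (h + 1))) * sphP n +
      ((C (1 / 2) * (h - 1)) * (C (1 / 2) * (h - 1))) * (-sphP n) := by
    have : (C (1 / 2) : MvPolynomial (Fin (n + 1)) ℝ) * 2 = 1 := by
      rw [show (2 : MvPolynomial (Fin (n + 1)) ℝ) = C 2 from rfl, ← C_mul]; norm_num
    linear_combination (-(sphP n * h) * (C (1 / 2) * 2 + 1)) * this
  rw [e]
  exact fullQ_add (fullQ_mul (IsSumSq.mul_self _) h1) (fullQ_mul (IsSumSq.mul_self _) h2)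

theorem putinar {n m : ℕ} (g : Fin m → MvPolynomial (Fin n) ℝ)
    (l : MvPolynomial (Fin (n + 1)) ℝ) (hl : ∀ x ∈ StS g, 0 < eval x l) :
    ∃ k, l ∈ QMod k (tGens g) := by
  apply fullQ_QMod
  by_contra hlQ
  have hPsub : sphPre n ⊆ fullQ (tGens g) := by
    rintro _ ⟨s, h, hs, rfl⟩
    exact fullQ_add (fullQ_sumSq hs) (fullQ_ideal g h)
  obtain ⟨φ, hφ, hφl⟩ := exists_char (sphPre n) (fullQ (tGens g))
    (by
      rintro _ ⟨s, h, hs, rfl⟩ f hf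
      rw [add_mul, mul_assoc]
      exact fullQ_add (fullQ_mul hs hf) (fullQ_ideal g _))
    hPsub (fun r hr a ha => sphPre_smul r hr ha) (fun a ha b hb => fullQ_add ha hb)
    (fun r hr a ha => by
      have := fullQ_mul (isSumSq_smul IsSumSq.one r hr) ha
      rwa [smul_mul_assoc, one_mul] at this)
    (fullQ_sumSq IsSumSq.one) sphPre_arch l hlQ
  have hev : ∀ p, φ p = eval (fun i => φ (X i)) p := by
    intro p
    have := aeval_unique φ
    rw [← aeval_eq_eval]
    exact DFunLike.congr_fun this p
  have hw : φ (sphP n) = 0 := by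
    apply le_antisymm
    · have := hφ _ (fullQ_ideal g (-1))
      rw [mul_neg, mul_one, map_neg] at this
      linarith
    · have := hφ _ (fullQ_ideal g 1)
      rwa [mul_one] at this
  refine absurd hφl (not_le.2 ?_)
  rw [hev]
  apply hl
  refine ⟨fun j => ?_, ?_, ?_⟩
  · rw [← hev]
    exact hφ _ (fullQ_gen (g := tGens g) (Sum.inl j))
  · exact hφ _ (fullQ_gen (g := tGens g) (Sum.inr 0))
  · simp only [sphP, map_sub, map_sum, map_pow, map_one] at hw
    linarith

/-- The moment conditions. -/
def momOK {n : ℕ} {ι : Type*} [Fintype ι] (k : ℕ) (g : ι → MvPolynomial (Fin n) ℝ)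
    (y : (Fin (n + 1) →₀ ℕ) → ℝ) : Prop :=
      (∀ q : MvPolynomial (Fin (n + 1)) ℝ, q.totalDegree ≤ k → 0 ≤ riesz y (q ^ 2)) ∧
      (∀ q : MvPolynomial (Fin (n + 1)) ℝ, q.totalDegree ≤ k - 1 → 0 ≤ riesz y (X 0 * q ^ 2)) ∧
      (∀ q : MvPolynomial (Fin (n + 1)) ℝ, q.totalDegree ≤ 2 * (k - 1) →
        riesz y (((∑ i, X i ^ 2) - 1) * q) = 0) ∧
      (∀ j : ι, ∀ q : MvPolynomial (Fin (n + 1)) ℝ,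
        q.totalDegree ≤ k - ((g j).totalDegree + 1) / 2 → 0 ≤ riesz y (homog (g j) * q ^ 2))

theorem mem_omega {n : ℕ} {ι : Type*} [Fintype ι] (k : ℕ) (g : ι → MvPolynomial (Fin n) ℝ)
    (x : Fin n → ℝ) : x ∈ omegaRel k g ↔ ∃ y, momOK k g y ∧
      ∀ i, riesz y (X i) = (Fin.cons 1 x : Fin (n + 1) → ℝ) i := by
  constructor
  · rintro ⟨y, h1, h2, h3⟩
    exact ⟨y, h3, fun i => by refine Fin.cases ?_ ?_ i <;> simp [h1, h2]⟩
  · rintro ⟨y, h1, h2⟩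
    exact ⟨y, by simpa using h2 0, fun i => by simpa using h2 i.succ, h1⟩

theorem riesz_zero {m : ℕ} (y : (Fin m →₀ ℕ) → ℝ) : riesz y 0 = 0 := by simp [riesz_eq]

theorem riesz_sos_mul {m : ℕ} (y : (Fin m →₀ ℕ) → ℝ) (s h : MvPolynomial (Fin m) ℝ) (d k : ℕ)
    (hs : IsSumSq s) (hd : (s * h).totalDegree ≤ 2 * k) (hh : h ≠ 0 → h.totalDegree = d)
    (hy : ∀ q : MvPolynomial (Fin m) ℝ, q.totalDegree ≤ k - (d + 1) / 2 → 0 ≤ riesz y (h * q ^ 2)) :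
    0 ≤ riesz y (s * h) := by
  by_cases h0 : h = 0
  · simp [h0, riesz_zero]
  by_cases hs0 : s = 0
  · simp [hs0, riesz_zero]
  rw [totalDegree_mul_of_isDomain hs0 h0, hh h0] at hd
  obtain ⟨N, q, rfl⟩ := sumSq_repr hs
  have hq := sumSq_degree q (k - (d + 1) / 2) (by omega)
  rw [Finset.sum_mul, riesz_sum]
  refine Finset.sum_nonneg fun i _ => ?_
  have := hy _ (hq i)
  rwa [show q i * q i * h = h * q i ^ 2 by ring]

theorem sphere_deg (n : ℕ) : (((∑ i, X i ^ 2) - 1 : MvPolynomial (Fin (n + 1)) ℝ)).totalDegree = 2 := by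
  apply le_antisymm
  · refine (totalDegree_sub _ _).trans (max_le ?_ (by simp))
    refine totalDegree_finsetSum_le fun i _ => ?_
    simp
  · have hc : coeff (Finsupp.single 0 2) ((∑ i, X i ^ 2) - 1 : MvPolynomial (Fin (n + 1)) ℝ) ≠ 0 := by
      rw [coeff_sub, coeff_sum]
      have h0 : (0 : Fin (n + 1) →₀ ℕ) ≠ Finsupp.single 0 2 := by
        intro h
        have := DFunLike.congr_fun h 0
        simp at this
      simp [coeff_X_pow, coeff_one, Finsupp.single_left_inj, h0]
    have := le_totalDegree (mem_support_iff.2 hc)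
    simpa using this

theorem sphere_ne (n : ℕ) : ((∑ i, X i ^ 2) - 1 : MvPolynomial (Fin (n + 1)) ℝ) ≠ 0 := by
  intro h
  have := sphere_deg n
  rw [h] at this
  simp at this

theorem riesz_QMod {n m : ℕ} (k : ℕ) (g : Fin m → MvPolynomial (Fin n) ℝ)
    (y : (Fin (n + 1) →₀ ℕ) → ℝ) (hy : momOK k g y) (p : MvPolynomial (Fin (n + 1)) ℝ)
    (hp : p ∈ QMod k (tGens g)) : 0 ≤ riesz y p := by
  obtain ⟨s₀, s, hs₀, hd₀, hs, rfl⟩ := hp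
  obtain ⟨h1, h2, h3, h4⟩ := hy
  have hsph : ∀ q : MvPolynomial (Fin (n + 1)) ℝ,
      (q * ((∑ i, X i ^ 2) - 1)).totalDegree ≤ 2 * k →
      riesz y (q * ((∑ i, X i ^ 2) - 1)) = 0 := by
    intro q hq
    by_cases hq0 : q = 0
    · simp [hq0, riesz_zero]
    rw [totalDegree_mul_of_isDomain hq0 (sphere_ne n), sphere_deg] at hq
    rw [mul_comm]
    exact h3 q (by omega)
  rw [riesz_add, riesz_sum, Fintype.sum_sum_type, Fin.sum_univ_three]
  refine add_nonneg ?_ (add_nonneg ?_ (add_nonneg (add_nonneg ?_ ?_) ?_))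
  · have := riesz_sos_mul y s₀ 1 0 k hs₀ (by simpa using hd₀) (by simp) (fun q hq => by
      rw [one_mul]; exact h1 q (by simpa using hq))
    simpa using this
  · refine Finset.sum_nonneg fun j _ => ?_
    refine riesz_sos_mul y (s (Sum.inl j)) (homog (g j)) (g j).totalDegree k (hs _).1 (hs _).2 ?_
      (h4 j)
    intro hne
    exact (homog_isHom (g j)).totalDegree hne
  · exact riesz_sos_mul y (s (Sum.inr 0)) (X 0) 1 k (hs _).1 (hs _).2 (by simp)
      (fun q hq => h2 q (by simpa using hq))
  · exact (hsph _ (hs (Sum.inr 1)).2).ge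
  · have e : s (Sum.inr 2) * tGens g (Sum.inr 2) = (-s (Sum.inr 2)) * ((∑ i, X i ^ 2) - 1) := by
      simp only [tGens, Sum.elim_inr, Matrix.cons_val]
      ring
    have := (hs (Sum.inr 2)).2
    rw [e] at this ⊢
    exact (hsph _ this).ge

theorem omega_anti {n m : ℕ} (g : Fin m → MvPolynomial (Fin n) ℝ) :
    Antitone fun k => omegaRel k g := by
  rintro k k' hk x ⟨y, h1, h2, h3, h4, h5, h6⟩
  exact ⟨y, h1, h2, fun q hq => h3 q (by omega), fun q hq => h4 q (by omega),
    fun q hq => h5 q (by omega), fun j q hq => h6 j q (by omega)⟩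

theorem momOK_point {n m : ℕ} (k : ℕ) (g : Fin m → MvPolynomial (Fin n) ℝ) (r : ℝ) (hr : 0 ≤ r)
    (v : Fin (n + 1) → ℝ) (hv : v ∈ StS g) :
    momOK k g (fun α => r * ∏ i ∈ α.support, v i ^ α i) := by
  obtain ⟨h1, h2, h3⟩ := hv
  refine ⟨fun q _ => ?_, fun q _ => ?_, fun q _ => ?_, fun j q _ => ?_⟩
  · rw [riesz_point, map_pow]; positivity
  · rw [riesz_point, map_mul, map_pow, eval_X]; positivity
  · rw [riesz_point, map_mul]
    simp [h3]
  · rw [riesz_point, map_mul, map_pow]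
    have := h1 j
    positivity

theorem momOK_zero {n m : ℕ} (k : ℕ) (g : Fin m → MvPolynomial (Fin n) ℝ) :
    momOK k g 0 := by
  have : ∀ p, riesz (0 : (Fin (n + 1) →₀ ℕ) → ℝ) p = 0 := fun p => by simp [riesz]
  simp [momOK, this]

theorem StC_normalize {n m : ℕ} (g : Fin m → MvPolynomial (Fin n) ℝ) (u : Fin (n + 1) → ℝ)
    (hu : u ∈ StC g) (hu0 : u ≠ 0) : ∃ r : ℝ, 0 < r ∧ ∃ v ∈ StS g, u = r • v := by
  have hpos : 0 < ∑ i, u i ^ 2 := by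
    by_contra h
    apply hu0
    have h0 : ∑ i, u i ^ 2 = 0 := le_antisymm (not_lt.1 h) (Finset.sum_nonneg fun i _ => sq_nonneg _)
    rw [Finset.sum_eq_zero_iff_of_nonneg fun i _ => sq_nonneg _] at h0
    ext i
    simpa using h0 i (Finset.mem_univ i)
  set r := Real.sqrt (∑ i, u i ^ 2) with hr
  have hr0 : 0 < r := Real.sqrt_pos.2 hpos
  refine ⟨r, hr0, r⁻¹ • u, ⟨fun j => ?_, ?_, ?_⟩, ?_⟩
  · rw [eval_homog_smul]
    exact mul_nonneg (by positivity) (hu.1 j)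
  · exact mul_nonneg (by positivity) hu.2
  · simp only [Pi.smul_apply, smul_eq_mul, mul_pow]
    rw [← Finset.mul_sum, inv_pow, Real.sq_sqrt hpos.le, inv_mul_cancel₀ hpos.ne']
  · rw [smul_smul, mul_inv_cancel₀ hr0.ne', one_smul]

theorem StS_sub_StC {n m : ℕ} (g : Fin m → MvPolynomial (Fin n) ℝ) : StS g ⊆ StC g :=
  fun _ h => ⟨h.1, h.2.1⟩

theorem conv_StC_mom {n m : ℕ} (k : ℕ) (g : Fin m → MvPolynomial (Fin n) ℝ) :
    convexHull ℝ (StC g) ⊆ {z | ∃ y, momOK k g y ∧ ∀ i, riesz y (X i) = z i} := by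
  apply convexHull_min
  · intro u hu
    by_cases hu0 : u = 0
    · exact ⟨0, momOK_zero k g, fun i => by simp [hu0, riesz]⟩
    · obtain ⟨r, hr, v, hv, rfl⟩ := StC_normalize g u hu hu0
      exact ⟨_, momOK_point k g r hr.le v hv, fun i => by rw [riesz_point]; simp⟩
  · rintro u ⟨y, ⟨h1, h2, h3, h4⟩, h5⟩ v ⟨z, ⟨k1, k2, k3, k4⟩, k5⟩ a b ha hb hab
    refine ⟨a • y + b • z, ⟨fun q hq => ?_, fun q hq => ?_, fun q hq => ?_, fun j q hq => ?_⟩,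
      fun i => ?_⟩
    · rw [riesz_comb]
      exact add_nonneg (mul_nonneg ha (h1 q hq)) (mul_nonneg hb (k1 q hq))
    · rw [riesz_comb]
      exact add_nonneg (mul_nonneg ha (h2 q hq)) (mul_nonneg hb (k2 q hq))
    · rw [riesz_comb, h3 q hq, k3 q hq]; simp
    · rw [riesz_comb]
      exact add_nonneg (mul_nonneg ha (h4 j q hq)) (mul_nonneg hb (k4 j q hq))
    · rw [riesz_comb, h5, k5]; simp

theorem cone_of_closure {n m : ℕ} (g : Fin m → MvPolynomial (Fin n) ℝ) (hA : AssumpA g)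
    (x : Fin n → ℝ) (hx : x ∈ closure (convexHull ℝ (semiS g))) :
    (Fin.cons 1 x : Fin (n + 1) → ℝ) ∈ convexHull ℝ (StC g) := by
  obtain ⟨h1, h2, h3⟩ := hA
  rw [h1] at h2
  have hcont : Continuous fun x : Fin n → ℝ => (Fin.cons 1 x : Fin (n + 1) → ℝ) := by
    refine continuous_pi fun i => ?_
    refine Fin.cases ?_ (fun i => ?_) i
    · simp only [Fin.cons_zero]; fun_prop
    · simp only [Fin.cons_succ]; fun_prop
  have hsub : convexHull ℝ (semiS g) ⊆
      (fun x : Fin n → ℝ => (Fin.cons 1 x : Fin (n + 1) → ℝ)) ⁻¹' convexHull ℝ (StC g) := by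
    apply convexHull_min
    · intro x hx
      apply subset_convexHull
      exact ⟨fun j => by rw [eval_homog]; exact hx j, by simp⟩
    · intro u hu v hv a b ha hb hab
      have := convex_convexHull ℝ (StC g) hu hv ha hb hab
      simp only [Set.mem_preimage]
      convert this using 1
      ext i
      refine Fin.cases ?_ (fun i => ?_) i <;> simp [hab]
  exact closure_minimal hsub (h2.preimage hcont) hx

theorem closure_of_cone {n m : ℕ} (g : Fin m → MvPolynomial (Fin n) ℝ) (hA : AssumpA g)
    (x : Fin n → ℝ) (hx : (Fin.cons 1 x : Fin (n + 1) → ℝ) ∈ convexHull ℝ (StC g)) :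
    x ∈ closure (convexHull ℝ (semiS g)) := by
  obtain ⟨h1, h2, h3⟩ := hA
  rw [← h1] at hx
  have hx' : (Fin.cons 1 x : Fin (n + 1) → ℝ) ∈ closure (convexHull ℝ (StO g)) :=
    convexHull_min (closure_mono (subset_convexHull ℝ _)) (convex_convexHull ℝ _).closure hx
  let p : (Fin (n + 1) → ℝ) → (Fin n → ℝ) := fun u i => (u 0)⁻¹ * u i.succ
  have hsub : convexHull ℝ (StO g) ⊆ {u | 0 < u 0 ∧ p u ∈ convexHull ℝ (semiS g)} := by
    apply convexHull_min
    · intro u hu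
      refine ⟨hu.2, subset_convexHull ℝ _ fun j => ?_⟩
      have e : (Fin.cons 1 (p u) : Fin (n + 1) → ℝ) = (u 0)⁻¹ • u := by
        ext i
        refine Fin.cases ?_ (fun i => ?_) i
        · simp [inv_mul_cancel₀ hu.2.ne']
        · simp [p]
      rw [← eval_homog, e, eval_homog_smul]
      have := hu.1 j
      have := hu.2
      positivity
    · rintro u ⟨hu0, hu⟩ v ⟨hv0, hv⟩ a b ha hb hab
      have hpos : 0 < a * u 0 + b * v 0 := by
        rcases ha.eq_or_lt with rfl | ha
        · have : b = 1 := by linarith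
          simp [this, hv0]
        · positivity
      refine ⟨by simpa using hpos, ?_⟩
      have := convex_convexHull ℝ (semiS g) hu hv (a := a * u 0 / (a * u 0 + b * v 0))
        (b := b * v 0 / (a * u 0 + b * v 0)) (by positivity) (by positivity) (by field_simp)
      convert this using 1
      ext i
      simp only [p, Pi.add_apply, Pi.smul_apply, smul_eq_mul]
      field_simp
  have hc : ContinuousAt p (Fin.cons 1 x) := by
    refine continuousAt_pi.2 fun i => ContinuousAt.mul (ContinuousAt.inv₀
      (continuous_apply 0).continuousAt (by simp)) (continuous_apply i.succ).continuousAt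
  have hpx : p (Fin.cons 1 x) = x := by ext i; simp [p]
  have := hc.continuousWithinAt.mem_closure_image hx'
  rw [hpx] at this
  refine closure_mono ?_ this
  rintro _ ⟨u, hu, rfl⟩
  exact (hsub hu).2

theorem cone_smul {n m : ℕ} (g : Fin m → MvPolynomial (Fin n) ℝ) (t : ℝ) (ht : 0 < t)
    (u : Fin (n + 1) → ℝ) (hu : u ∈ convexHull ℝ (StC g)) : t • u ∈ convexHull ℝ (StC g) := by
  have : convexHull ℝ (StC g) ⊆ {u | t • u ∈ convexHull ℝ (StC g)} := by
    apply convexHull_min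
    · intro u hu
      refine subset_convexHull ℝ _ ⟨fun j => ?_, ?_⟩
      · rw [eval_homog_smul]
        exact mul_nonneg (by positivity) (hu.1 j)
      · exact mul_nonneg ht.le hu.2
    · intro u hu v hv a b ha hb hab
      have := convex_convexHull ℝ (StC g) hu hv ha hb hab
      simp only [Set.mem_ofPred_eq]
      convert this using 1
      module
  exact this hu

theorem cone_sep {n m : ℕ} (g : Fin m → MvPolynomial (Fin n) ℝ) (hA : AssumpA g)
    (z : Fin (n + 1) → ℝ) (hz : z ∉ convexHull ℝ (StC g)) :
    ∃ f : (Fin (n + 1) → ℝ) →L[ℝ] ℝ, (∀ c ∈ convexHull ℝ (StC g), 0 ≤ f c) ∧ f z < 0 := by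
  obtain ⟨h1, h2, h3⟩ := hA
  rw [h1] at h2 h3
  have h0 : (0 : Fin (n + 1) → ℝ) ∈ convexHull ℝ (StC g) := by
    have : (0 : Fin (n + 1) → ℝ) ∈ convexHull ℝ (StC g) ∩ -convexHull ℝ (StC g) := by
      rw [h3]; rfl
    exact this.1
  obtain ⟨f, u, hfz, hf⟩ := geometric_hahn_banach_point_closed (convex_convexHull ℝ _) h2 hz
  have hu := hf 0 h0
  rw [map_zero] at hu
  refine ⟨f, fun c hc => ?_, hfz.trans hu⟩
  by_contra hneg
  push Not at hneg
  have := hf _ (cone_smul g (u / f c) (div_pos_of_neg_of_neg hu hneg) c hc)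
  rw [map_smul, smul_eq_mul, div_mul_cancel₀ _ hneg.ne] at this
  exact lt_irrefl _ this

theorem StS_compact {n m : ℕ} (g : Fin m → MvPolynomial (Fin n) ℝ) : IsCompact (StS g) := by
  have hsub : StS g ⊆ Set.univ.pi fun _ => Set.Icc (-1 : ℝ) 1 := by
    rintro x ⟨-, -, h⟩ i -
    have : x i ^ 2 ≤ 1 := by
      rw [← h]
      exact Finset.single_le_sum (f := fun i => x i ^ 2) (fun _ _ => sq_nonneg _)
        (Finset.mem_univ i)
    exact abs_le.1 ((sq_le_one_iff_abs_le_one _).1 this)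
  refine (isCompact_univ_pi fun _ => isCompact_Icc).of_isClosed_subset ?_ hsub
  have : StS g = (⋂ j, {x | 0 ≤ eval x (homog (g j))}) ∩ ({x | 0 ≤ x 0} ∩ {x | ∑ i, x i ^ 2 = 1}) := by
    ext x; simp [StS]
  rw [this]
  refine IsClosed.inter (isClosed_iInter fun j => ?_) (IsClosed.inter ?_ ?_)
  · exact isClosed_le continuous_const (MvPolynomial.continuous_eval _)
  · exact isClosed_le (by fun_prop) (by fun_prop)
  · exact isClosed_eq (by fun_prop) (by fun_prop)

theorem strict_form {n m : ℕ} (g : Fin m → MvPolynomial (Fin n) ℝ) (hA : AssumpA g) :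
    ∃ f : (Fin (n + 1) → ℝ) →L[ℝ] ℝ, ∀ v ∈ StS g, 0 < f v := by
  have hex : ∀ v ∈ StS g, ∃ f : (Fin (n + 1) → ℝ) →L[ℝ] ℝ,
      (∀ c ∈ convexHull ℝ (StC g), 0 ≤ f c) ∧ 0 < f v := by
    intro v hv
    have hnot : -v ∉ convexHull ℝ (StC g) := by
      intro hm
      have h3 := hA.2.2
      rw [hA.1] at h3
      have : v ∈ convexHull ℝ (StC g) ∩ -convexHull ℝ (StC g) :=
        ⟨subset_convexHull ℝ _ (StS_sub_StC g hv), hm⟩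
      rw [h3] at this
      have hv0 : v = 0 := this
      have := hv.2.2
      simp [hv0] at this
    obtain ⟨f, hf, hfv⟩ := cone_sep g hA _ hnot
    exact ⟨f, hf, by rw [map_neg] at hfv; linarith⟩
  choose! f hf hfv using hex
  obtain ⟨t, htS, ht⟩ := (StS_compact g).elim_nhds_subcover (fun v => {w | 0 < f v w})
    (fun v hv => (isOpen_lt continuous_const (f v).continuous).mem_nhds (hfv v hv))
  refine ⟨∑ v ∈ t, f v, fun w hw => ?_⟩
  obtain ⟨v, hv, hwv⟩ := Set.mem_iUnion₂.1 (ht hw)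
  rw [_root_.sum_apply]
  exact Finset.sum_pos' (fun u hu => hf u (htS u hu) w (subset_convexHull ℝ _ (StS_sub_StC g hw)))
    ⟨v, hv, hwv⟩

theorem exists_form {n m : ℕ} (g : Fin m → MvPolynomial (Fin n) ℝ) (hA : AssumpA g)
    (x : Fin n → ℝ) (hx : x ∉ closure (convexHull ℝ (semiS g))) :
    ∃ l : Fin (n + 1) → ℝ, (∀ v ∈ StS g, 0 < ∑ i, l i * v i) ∧
      ∑ i, l i * (Fin.cons 1 x : Fin (n + 1) → ℝ) i < 0 := by
  obtain ⟨f, hf, hfx⟩ := cone_sep g hA (Fin.cons 1 x) fun h => hx (closure_of_cone g hA x h)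
  obtain ⟨f₀, hf₀⟩ := strict_form g hA
  obtain ⟨δ, hδ, hδx⟩ : ∃ δ : ℝ, 0 < δ ∧ f (Fin.cons 1 x) + δ * f₀ (Fin.cons 1 x) < 0 := by
    set a := f (Fin.cons 1 x)
    set b := f₀ (Fin.cons 1 x)
    refine ⟨-a / (2 * (|b| + 1)), by
      apply div_pos (by linarith) (by positivity), ?_⟩
    have h1 : -a / (2 * (|b| + 1)) * b ≤ -a / (2 * (|b| + 1)) * (|b| + 1) :=
      mul_le_mul_of_nonneg_left (by linarith [le_abs_self b])
        (div_nonneg (by linarith) (by positivity))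
    have h2 : -a / (2 * (|b| + 1)) * (|b| + 1) = -a / 2 := by
      have : |b| + 1 ≠ 0 := by positivity
      field_simp
    linarith
  have hrep : ∀ u, (f + δ • f₀) u = ∑ i, (f + δ • f₀) (Pi.single i 1) * u i := by
    intro u
    conv_lhs => rw [← Finset.univ_sum_single u]
    rw [map_sum]
    refine Finset.sum_congr rfl fun i _ => ?_
    rw [mul_comm, ← smul_eq_mul, ← map_smul]
    congr 1
    ext j
    simp [Pi.single_apply]
  refine ⟨fun i => (f + δ • f₀) (Pi.single i 1), fun v hv => ?_, ?_⟩
  · rw [← hrep]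
    have := hf v (subset_convexHull ℝ _ (StS_sub_StC g hv))
    have := hf₀ v hv
    simp only [_root_.add_apply, _root_.smul_apply, smul_eq_mul]
    positivity
  · rw [← hrep]
    simpa using hδx

theorem riesz_linear {n : ℕ} (y : (Fin (n + 1) →₀ ℕ) → ℝ) (l : Fin (n + 1) → ℝ) :
    riesz y (∑ i, C (l i) * X i) = ∑ i, l i * riesz y (X i) := by
  rw [riesz_sum]
  refine Finset.sum_congr rfl fun i _ => ?_
  rw [← smul_eq_C_mul, riesz_smul]

theorem closure_sub_omega {n m : ℕ} (g : Fin m → MvPolynomial (Fin n) ℝ) (hA : AssumpA g) (k : ℕ) :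
    closure (convexHull ℝ (semiS g)) ⊆ omegaRel k g := fun x hx =>
  (mem_omega k g x).2 (conv_StC_mom k g (cone_of_closure g hA x hx))

theorem not_mem_omega {n m : ℕ} (g : Fin m → MvPolynomial (Fin n) ℝ) (hA : AssumpA g)
    (x : Fin n → ℝ) (hx : x ∉ closure (convexHull ℝ (semiS g))) :
    ∃ k, x ∉ closure (omegaRel k g) := by
  obtain ⟨l, hl, hlx⟩ := exists_form g hA x hx
  obtain ⟨k, hk⟩ := putinar g (∑ i, C (l i) * X i) (fun v hv => by simpa using hl v hv)
  refine ⟨k, fun hmem => ?_⟩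
  have hcl : IsClosed {x : Fin n → ℝ | 0 ≤ ∑ i, l i * (Fin.cons 1 x : Fin (n + 1) → ℝ) i} := by
    simp only [Fin.sum_univ_succ, Fin.cons_zero, Fin.cons_succ]
    exact isClosed_le (by fun_prop) (by fun_prop)
  have := closure_minimal (t := {x : Fin n → ℝ | 0 ≤ ∑ i, l i * (Fin.cons 1 x : Fin (n + 1) → ℝ) i})
    (s := omegaRel k g) (by
      intro z hz
      obtain ⟨y, hy, hyz⟩ := (mem_omega k g z).1 hz
      have := riesz_QMod k g y hy _ hk
      rw [riesz_linear] at this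
      simp only [hyz] at this
      exact this) hcl hmem
  exact absurd hlx (not_lt.2 this)

theorem inter_omega {n m : ℕ} (g : Fin m → MvPolynomial (Fin n) ℝ) (hA : AssumpA g) :
    closure (convexHull ℝ (semiS g)) = ⋂ k : ℕ, closure (omegaRel (k + 1) g) := by
  apply Set.Subset.antisymm
  · exact Set.subset_iInter fun k => (closure_sub_omega g hA (k + 1)).trans subset_closure
  · intro x hx
    by_contra hc
    obtain ⟨k, hk⟩ := not_mem_omega g hA x hc
    exact hk (closure_mono (omega_anti g (Nat.le_succ k)) (Set.mem_iInter.1 hx k))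

theorem omega_ppBDR {n m : ℕ} (g : Fin m → MvPolynomial (Fin n) ℝ) (hA : AssumpA g) (k : ℕ)
    (hk : ppBDR k g (StS g)) : omegaRel k g ⊆ closure (convexHull ℝ (semiS g)) := by
  intro x hx
  by_contra hc
  obtain ⟨l, hl, hlx⟩ := exists_form g hA x hc
  obtain ⟨y, hy, hyx⟩ := (mem_omega k g x).1 hx
  have ev1 : ∀ᶠ c in nhds (Fin.cons 0 l : Fin (n + 2) → ℝ), ∀ v ∈ StS g,
      0 < c 0 + ∑ i : Fin (n + 1), c i.succ * v i := by
    apply (StS_compact g).eventually_forall_of_forall_eventually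
    intro v hv
    have hcont : Continuous fun z : (Fin (n + 2) → ℝ) × (Fin (n + 1) → ℝ) =>
        z.1 0 + ∑ i : Fin (n + 1), z.1 i.succ * z.2 i := by fun_prop
    refine (isOpen_lt continuous_const hcont).mem_nhds ?_
    simpa using hl v hv
  have ev2 : ∀ᶠ c in nhds (Fin.cons 0 l : Fin (n + 2) → ℝ),
      c 0 * riesz y 1 + ∑ i : Fin (n + 1), c i.succ * (Fin.cons 1 x : Fin (n + 1) → ℝ) i < 0 := by
    have hcont : Continuous fun c : Fin (n + 2) → ℝ => c 0 * riesz y 1 +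
        ∑ i : Fin (n + 1), c i.succ * (Fin.cons 1 x : Fin (n + 1) → ℝ) i := by fun_prop
    refine (isOpen_lt hcont continuous_const).mem_nhds ?_
    simpa using hlx
  have hpos := MeasureTheory.Measure.measure_pos_of_mem_nhds MeasureTheory.volume (ev1.and ev2)
  refine absurd hk (ne_of_gt (lt_of_lt_of_le hpos (MeasureTheory.measure_mono ?_)))
  rintro c ⟨h1, h2⟩
  refine ⟨h1, fun hQ => ?_⟩
  have := riesz_QMod k g y hy _ hQ
  rw [riesz_add, riesz_linear y (fun i => c i.succ), show (C (c 0) : MvPolynomial (Fin (n + 1)) ℝ)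
    = c 0 • 1 by rw [smul_eq_C_mul, mul_one], riesz_smul] at this
  simp only [hyx] at this
  linarith

theorem unif_conv {n m : ℕ} (g : Fin m → MvPolynomial (Fin n) ℝ) (hA : AssumpA g) (ε r : ℝ)
    (hε : 0 < ε) : ∃ k : ℕ,
        closure (omegaRel k g) ∩ {x : Fin n → ℝ | ∑ i, x i ^ 2 ≤ r ^ 2} ⊆
          (closure (convexHull ℝ (semiS g)) + ε • {x : Fin n → ℝ | ∑ i, x i ^ 2 ≤ 1}) := by
  have hBc : IsCompact {x : Fin n → ℝ | ∑ i, x i ^ 2 ≤ r ^ 2} := by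
    refine (isCompact_univ_pi fun _ : Fin n => isCompact_Icc (a := -|r|) (b := |r|)).of_isClosed_subset
      (isClosed_le (by fun_prop) (by fun_prop)) ?_
    intro x hx i _
    have : x i ^ 2 ≤ r ^ 2 := le_trans
      (Finset.single_le_sum (f := fun i => x i ^ 2) (fun _ _ => sq_nonneg _)
        (Finset.mem_univ i)) hx
    exact abs_le.1 (sq_le_sq.1 this)
  let V : ℕ → Set (Fin n → ℝ) := fun k =>
    closure (omegaRel (k + 1) g) ∩ {x : Fin n → ℝ | ∑ i, x i ^ 2 ≤ r ^ 2}
  have hanti : Antitone V := fun a b hab => Set.inter_subset_inter_left _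
    (closure_mono (omega_anti g (Nat.succ_le_succ hab)))
  obtain ⟨k, hk⟩ := exists_subset_nhds_of_isCompact (V := V)
    (U := closure (convexHull ℝ (semiS g)) + ε • {x : Fin n → ℝ | ∑ i, x i ^ 2 ≤ 1})
    hanti.directed_ge (fun i => hBc.inter_left isClosed_closure) (by
      intro x hx
      have hxc : x ∈ closure (convexHull ℝ (semiS g)) := by
        rw [inter_omega g hA]
        exact Set.mem_iInter.2 fun k => (Set.mem_iInter.1 hx k).1
      have hopen : IsOpen {z : Fin n → ℝ | ∑ i, (ε⁻¹ * (z i - x i)) ^ 2 < 1} :=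
        isOpen_lt (by fun_prop) (by fun_prop)
      refine Filter.mem_of_superset (hopen.mem_nhds (by simp)) ?_
      intro z hz
      refine Set.mem_add.2 ⟨x, hxc, z - x, Set.mem_smul_set.2 ⟨ε⁻¹ • (z - x), ?_, ?_⟩, by simp⟩
      · have hz' : ∑ i, (ε⁻¹ * (z i - x i)) ^ 2 < 1 := hz
        exact hz'.le
      · rw [smul_smul, mul_inv_cancel₀ hε.ne', one_smul])
  exact ⟨k + 1, hk⟩

/-- Corollary 3.10: under Assumption A, (1) `closure (conv S) ⊆ Ω_k(G̃)` for all `k` and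
`closure (conv S) = ⋂_{k=1}^∞ closure (Ω_k(G̃))`; (2) if PP-BDR holds for `S̃` with order
`k'` then `closure (conv S) = closure (Ω_{k'}(G̃))`; (3) uniform convergence on every ball. -/
theorem stmt11 (n m : ℕ) (g : Fin m → MvPolynomial (Fin n) ℝ) (hA : AssumpA g) :
    ((∀ k : ℕ, closure (convexHull ℝ (semiS g)) ⊆ omegaRel k g) ∧
      closure (convexHull ℝ (semiS g)) = ⋂ k : ℕ, closure (omegaRel (k + 1) g)) ∧
    (∀ k' : ℕ, ppBDR k' g (StS g) →
      closure (convexHull ℝ (semiS g)) = closure (omegaRel k' g)) ∧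
    (∀ ε r : ℝ, 0 < ε → 0 < r →
      (closure (convexHull ℝ (semiS g)) ∩
        {x : Fin n → ℝ | ∑ i, x i ^ 2 ≤ r ^ 2}).Nonempty →
      ∃ k : ℕ,
        closure (convexHull ℝ (semiS g)) ∩ {x : Fin n → ℝ | ∑ i, x i ^ 2 ≤ r ^ 2} ⊆
          closure (omegaRel k g) ∩ {x : Fin n → ℝ | ∑ i, x i ^ 2 ≤ r ^ 2} ∧
        closure (omegaRel k g) ∩ {x : Fin n → ℝ | ∑ i, x i ^ 2 ≤ r ^ 2} ⊆
          (closure (convexHull ℝ (semiS g)) + ε • {x : Fin n → ℝ | ∑ i, x i ^ 2 ≤ 1}) ∩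
            {x : Fin n → ℝ | ∑ i, x i ^ 2 ≤ r ^ 2}) := by
  refine ⟨⟨closure_sub_omega g hA, inter_omega g hA⟩, fun k hk => ?_, fun ε r hε _ _ => ?_⟩
  · exact Set.Subset.antisymm ((closure_sub_omega g hA k).trans subset_closure)
      (closure_minimal (omega_ppBDR g hA k hk) isClosed_closure)
  · obtain ⟨k, hk⟩ := unif_conv g hA ε r hε
    exact ⟨k, Set.inter_subset_inter_left _ ((closure_sub_omega g hA k).trans subset_closure),
      Set.subset_inter hk Set.inter_subset_right⟩
end

section
/- Let S = {x ∈ ℝⁿ : g₁(x) ≥ 0, …, g_m(x) ≥ 0} be nonempty and fix k ∈ ℕ. Identify the truncated quadratic module Q_k(G̃) with the convex cone of coefficient vectors of its elements in ℝ^{s̃(2k)}, where s̃(2k) = dim ℝ[X₀,…,X_n]_{2k}, let Q_k(G̃)* ⊆ ℝ^{s̃(2k)} be its dual cone, and let π : ℝ^{s̃(2k)} → ℝ^{n+1} be the coordinate projection onto the entries indexed by the degree-one monomials X₀, X₁, …, X_n. If Q_k(G̃) is closed, then the affine set M := {(1,x) : x ∈ ℝⁿ} ⊆ ℝ^{n+1}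 intersects the relative interior of π(Q_k(G̃)*). -/
open MvPolynomial Pointwise

/-- Key convexity fact: the relative interior of a convex cone is stable under
`v ↦ a • v + c` for `a > 0` and `c` in the cone. -/
lemma relint_cone_aux {N : ℕ} (K : Set (Fin N → ℝ)) (h0 : (0 : Fin N → ℝ) ∈ K)
    (hadd : ∀ v ∈ K, ∀ w ∈ K, v + w ∈ K) (hsmul : ∀ a : ℝ, 0 ≤ a → ∀ v ∈ K, a • v ∈ K)
    {w c : Fin N → ℝ} (hw : w ∈ intrinsicInterior ℝ K) (hc : c ∈ K) {a : ℝ} (ha : 0 < a) :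
    a • w + c ∈ intrinsicInterior ℝ K := by
  have hwK : w ∈ K := intrinsicInterior_subset hw
  obtain ⟨y, hy, rfl⟩ := mem_intrinsicInterior.1 hw
  obtain ⟨V, hVs, hVo, hyV⟩ := mem_interior.1 hy
  obtain ⟨U, hUo, rfl⟩ := isOpen_induced_iff.1 hVo
  have hmem : a • (y : Fin N → ℝ) + c ∈ K := hadd _ (hsmul a ha.le _ hwK) _ hc
  refine mem_intrinsicInterior.2 ⟨⟨a • (y : Fin N → ℝ) + c, subset_affineSpan ℝ K hmem⟩, ?_, rfl⟩
  refine mem_interior.2 ⟨(fun v : affineSpan ℝ K => a⁻¹ • ((v : Fin N → ℝ) - c)) ⁻¹' U, ?_, ?_, ?_⟩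
  · intro v hv
    have hspan : a⁻¹ • ((v : Fin N → ℝ) - c) ∈ affineSpan ℝ K := by
      have := (affineSpan ℝ K).smul_vsub_vadd_mem a⁻¹ v.2 (subset_affineSpan ℝ K hc)
        (subset_affineSpan ℝ K h0)
      simpa using this
    have h1 : a⁻¹ • ((v : Fin N → ℝ) - c) ∈ K := hVs (a := ⟨_, hspan⟩) hv
    have h2 := hadd _ (hsmul a ha.le _ h1) _ hc
    rw [smul_smul, mul_inv_cancel₀ ha.ne', one_smul, sub_add_cancel] at h2
    exact h2
  · exact hUo.preimage (by fun_prop)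
  · have : a⁻¹ • ((a • (y : Fin N → ℝ) + c) - c) = y := by
      rw [add_sub_cancel_right, smul_smul, inv_mul_cancel₀ ha.ne', one_smul]
    simp only [Set.mem_preimage, this]
    exact hyV

lemma eval_homog_aux {n : ℕ} (f : MvPolynomial (Fin n) ℝ) (t : ℝ) (u : Fin n → ℝ) :
    eval (t • (Fin.cons 1 u : Fin (n + 1) → ℝ)) (homog f) = t ^ f.totalDegree * eval u f := by
  rw [homog, map_sum, eval_eq' u f, Finset.mul_sum]
  refine Finset.sum_congr rfl fun α hα => ?_
  have hd : (α.sum fun _ e => e) ≤ f.totalDegree := le_totalDegree hα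
  have hs : (α.sum fun _ e => e) = ∑ i, α i := Finsupp.sum_fintype _ _ (fun _ => rfl)
  rw [eval_monomial, Finsupp.prod_fintype _ _ (fun _ => pow_zero _), Fin.prod_univ_succ]
  have h1 : ∀ i : Fin n, (Finsupp.mapDomain Fin.succ α) i.succ = α i := fun i =>
    Finsupp.mapDomain_apply (Fin.succ_injective n) α i
  have h2 : (Finsupp.mapDomain Fin.succ α) (0 : Fin (n + 1)) = 0 :=
    Finsupp.mapDomain_of_notMem_range _ _ (by simp)
  simp only [Finsupp.add_apply, h1, h2, Pi.smul_apply, Fin.cons_zero, Fin.cons_succ, smul_eq_mul,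
    Finsupp.single_eq_same, zero_add, mul_one, mul_pow, Finset.prod_mul_distrib,
    Finset.prod_pow_eq_pow_sum]
  have h3 : ∀ i : Fin n, (Finsupp.single (0 : Fin (n + 1))
      (f.totalDegree - α.sum fun _ e => e)) i.succ = 0 := fun i => by
    simp [Finsupp.single_apply, (Fin.succ_ne_zero i).symm]
  simp only [h3, add_zero]
  rw [← hs]
  conv_rhs => rw [← Nat.sub_add_cancel hd, pow_add]
  ring

lemma isSumSq_eval_nonneg_aux {N : ℕ} {p : MvPolynomial (Fin N) ℝ} (hp : IsSumSq p)
    (z : Fin N → ℝ) : 0 ≤ eval z p := by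
  induction hp with
  | zero => simp
  | sq_add a _ ih =>
    rw [map_add, map_mul]
    exact add_nonneg (mul_self_nonneg _) ih

lemma riesz_eval_aux {N : ℕ} (z : Fin N → ℝ) (p : MvPolynomial (Fin N) ℝ) :
    riesz (fun α => ∏ i, z i ^ α i) p = eval z p := by
  rw [riesz, eval_eq']

/-- Lemma 3.16: if `S ≠ ∅` and the truncated quadratic module `Q_k(G̃)` (viewed as a cone of
coefficient vectors) is closed, then the affine set `M = {(1,x) : x ∈ ℝⁿ}` intersects the
relative interior of the projection of the dual cone `Q_k(G̃)*` onto the coordinates indexed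
by the degree-one monomials `X₀,…,Xₙ`. -/
theorem stmt12 (n m : ℕ) (g : Fin m → MvPolynomial (Fin n) ℝ) (k : ℕ)
    (hS : (semiS g).Nonempty)
    (hQclosed : IsClosed {f : (Fin (n + 1) →₀ ℕ) → ℝ |
      ∃ p ∈ QMod k (tGens g), f = fun α => MvPolynomial.coeff α p}) :
    ∃ x : Fin n → ℝ, Fin.cons 1 x ∈ intrinsicInterior ℝ
      ((fun y : (Fin (n + 1) →₀ ℕ) → ℝ => fun i : Fin (n + 1) => y (Finsupp.single i 1)) ''
        {y : (Fin (n + 1) →₀ ℕ) → ℝ | ∀ p ∈ QMod k (tGens g), 0 ≤ riesz y p}) := by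
  classical
  obtain ⟨u, hu⟩ := hS
  set K := ((fun y : (Fin (n + 1) →₀ ℕ) → ℝ => fun i : Fin (n + 1) => y (Finsupp.single i 1)) ''
        {y : (Fin (n + 1) →₀ ℕ) → ℝ | ∀ p ∈ QMod k (tGens g), 0 ≤ riesz y p}) with hK
  have h0 : (0 : Fin (n + 1) → ℝ) ∈ K :=
    ⟨0, fun p _ => by simp [riesz], rfl⟩
  have hadd : ∀ v ∈ K, ∀ w ∈ K, v + w ∈ K := by
    rintro _ ⟨y, hy, rfl⟩ _ ⟨y', hy', rfl⟩
    refine ⟨y + y', fun p hp => ?_, rfl⟩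
    have := add_nonneg (hy p hp) (hy' p hp)
    simpa [riesz, mul_add, Finset.sum_add_distrib] using this
  have hsmul : ∀ a : ℝ, 0 ≤ a → ∀ v ∈ K, a • v ∈ K := by
    rintro a ha _ ⟨y, hy, rfl⟩
    refine ⟨a • y, fun p hp => ?_, rfl⟩
    have := mul_nonneg ha (hy p hp)
    simpa [riesz, Finset.mul_sum, mul_left_comm] using this
  have hconv : Convex ℝ K := fun v hv w hw a b ha hb _ =>
    hadd _ (hsmul a ha v hv) _ (hsmul b hb w hw)
  -- a point of the cone with positive zeroth coordinate
  obtain ⟨p, hpK, hp0⟩ : ∃ p ∈ K, 0 < p 0 := by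
    set r : ℝ := 1 + ∑ i, u i ^ 2 with hr
    have hrpos : 0 < r := by positivity
    set t : ℝ := (Real.sqrt r)⁻¹ with ht
    have htpos : 0 < t := by positivity
    have ht2 : t ^ 2 * r = 1 := by
      rw [ht, inv_pow, Real.sq_sqrt hrpos.le, inv_mul_cancel₀ hrpos.ne']
    set z : Fin (n + 1) → ℝ := t • (Fin.cons 1 u : Fin (n + 1) → ℝ) with hz
    have hz0 : z 0 = t := by simp [hz]
    have hnorm : ∑ i, z i ^ 2 = 1 := by
      rw [Fin.sum_univ_succ]
      simp only [hz, Pi.smul_apply, Fin.cons_zero, Fin.cons_succ, smul_eq_mul, mul_pow,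
        ← Finset.mul_sum]
      rw [hr] at ht2; linarith
    refine ⟨z, ⟨fun α => ∏ i, z i ^ α i, ?_, ?_⟩, by rw [hz0]; exact htpos⟩
    · rintro _ ⟨s₀, s, hs₀, -, hs, rfl⟩
      rw [riesz_eval_aux, map_add, map_sum]
      refine add_nonneg (isSumSq_eval_nonneg_aux hs₀ z) (Finset.sum_nonneg fun i _ => ?_)
      rw [map_mul]
      refine mul_nonneg (isSumSq_eval_nonneg_aux (hs i).1 z) ?_
      rcases i with j | i
      · simp only [tGens, Sum.elim_inl]
        rw [hz, eval_homog_aux]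
        exact mul_nonneg (by positivity) (hu j)
      · fin_cases i
        · simpa [tGens, hz0] using htpos.le
        · simp [tGens, hnorm]
        · simp [tGens, hnorm]
    · funext i
      simp only
      rw [Finset.prod_eq_single i]
      · simp
      · intro j _ hj
        simp [Finsupp.single_apply, hj.symm]
      · simp
  obtain ⟨w, hw⟩ := (intrinsicInterior_nonempty hconv).2 ⟨0, h0⟩
  obtain ⟨b, hb0, hb⟩ : ∃ b : ℝ, 0 ≤ b ∧ 0 < w 0 + b * p 0 := by
    refine ⟨(|w 0| + 1) / p 0, by positivity, ?_⟩
    rw [div_mul_cancel₀ _ hp0.ne']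
    linarith [neg_abs_le (w 0)]
  set a : ℝ := (w 0 + b * p 0)⁻¹ with ha
  have hapos : 0 < a := inv_pos.2 hb
  have key := relint_cone_aux K h0 hadd hsmul hw (hsmul (a * b) (by positivity) p hpK) hapos
  refine ⟨Fin.tail (a • w + (a * b) • p), ?_⟩
  have h1 : (a • w + (a * b) • p) 0 = 1 := by
    simp only [Pi.add_apply, Pi.smul_apply, smul_eq_mul]
    rw [mul_assoc, ← mul_add, ha, inv_mul_cancel₀ hb.ne']
  rw [← h1, Fin.cons_self_tail]
  exact key
end

section
/- In the setting of the gluing theorem (S closed at ∞, S_e := S ∩ {x : (−1)^{e_j}x_j ≥ 0 for all j} for e ∈ {0,1}ⁿ, and PP-BDR holding for every S̃_e with common order k′), one has for every e ∈ {0,1}ⁿ the inclusions closure(conv(S_e)) ⊆ closure(Ω_{k′}(G̃_e)) ⊆ closure(conv(S)). -/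
open MvPolynomial Pointwise

namespace Stmt16Aux

lemma riesz_eq_of_subset {m : ℕ} (y : (Fin m →₀ ℕ) → ℝ) (p : MvPolynomial (Fin m) ℝ)
    (s : Finset (Fin m →₀ ℕ)) (h : p.support ⊆ s) :
    riesz y p = ∑ α ∈ s, coeff α p * y α := by
  unfold riesz
  apply Finset.sum_subset h
  intro α _ hα
  rw [notMem_support_iff.mp hα, zero_mul]

lemma riesz_add {m : ℕ} (y : (Fin m →₀ ℕ) → ℝ) (p q : MvPolynomial (Fin m) ℝ) :
    riesz y (p + q) = riesz y p + riesz y q := by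
  classical
  have h := support_add (p := p) (q := q)
  rw [riesz_eq_of_subset y (p + q) _ h, riesz_eq_of_subset y p (p.support ∪ q.support)
    Finset.subset_union_left, riesz_eq_of_subset y q (p.support ∪ q.support)
    Finset.subset_union_right, ← Finset.sum_add_distrib]
  simp [add_mul]

lemma riesz_smul {m : ℕ} (y : (Fin m →₀ ℕ) → ℝ) (c : ℝ) (p : MvPolynomial (Fin m) ℝ) :
    riesz y (c • p) = c * riesz y p := by
  have h : (c • p).support ⊆ p.support := support_smul
  rw [riesz_eq_of_subset y _ _ h, riesz, Finset.mul_sum]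
  simp [mul_assoc]

/-- The Riesz functional as a linear map. -/
noncomputable def rieszL {m : ℕ} (y : (Fin m →₀ ℕ) → ℝ) : MvPolynomial (Fin m) ℝ →ₗ[ℝ] ℝ where
  toFun := riesz y
  map_add' := riesz_add y
  map_smul' := riesz_smul y

lemma rieszL_apply {m : ℕ} (y : (Fin m →₀ ℕ) → ℝ) (p : MvPolynomial (Fin m) ℝ) :
    rieszL y p = riesz y p := rfl

lemma riesz_comb {m : ℕ} (y z : (Fin m →₀ ℕ) → ℝ) (a b : ℝ) (p : MvPolynomial (Fin m) ℝ) :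
    riesz (a • y + b • z) p = a * riesz y p + b * riesz z p := by
  simp only [riesz, Finset.mul_sum, ← Finset.sum_add_distrib, Pi.add_apply, Pi.smul_apply,
    smul_eq_mul]
  exact Finset.sum_congr rfl fun _ _ => by ring

lemma riesz_point {m : ℕ} (r : ℝ) (u : Fin m → ℝ) (p : MvPolynomial (Fin m) ℝ) :
    riesz (fun α => r * ∏ i, u i ^ α i) p = r * eval u p := by
  rw [eval_eq', riesz, Finset.mul_sum]
  exact Finset.sum_congr rfl fun _ _ => by ring

lemma eval_homog {n : ℕ} (f : MvPolynomial (Fin n) ℝ) (z : Fin (n + 1) → ℝ) (hz : 0 < z 0) :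
    eval z (homog f) = z 0 ^ f.totalDegree * eval (fun i => z i.succ / z 0) f := by
  rw [homog, map_sum, eval_eq', Finset.mul_sum]
  apply Finset.sum_congr rfl
  intro α hα
  have hd : (α.sum fun _ e => e) ≤ f.totalDegree := le_totalDegree hα
  have hs : (α.sum fun _ e => e) = ∑ i, α i := Finsupp.sum_fintype _ _ (by simp)
  rw [eval_monomial, Finsupp.prod_add_index' (by simp) (by intros; rw [pow_add]),
    Finsupp.prod_single_index (by simp), Finsupp.prod_mapDomain_index (by simp)
    (by intros; rw [pow_add]), Finsupp.prod_fintype _ _ (by simp)]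
  rw [hs] at hd ⊢
  simp only [div_pow, Finset.prod_div_distrib, Finset.prod_pow_eq_pow_sum]
  have h0 : z 0 ^ f.totalDegree = z 0 ^ (f.totalDegree - ∑ i, α i) * z 0 ^ (∑ i, α i) := by
    rw [← pow_add, Nat.sub_add_cancel hd]
  rw [h0]
  have := pow_pos hz (∑ i, α i)
  field_simp

lemma homog_isHomogeneous {n : ℕ} (f : MvPolynomial (Fin n) ℝ) :
    (homog f).IsHomogeneous f.totalDegree := by
  apply IsHomogeneous.sum
  intro α hα
  have hd : (α.sum fun _ e => e) ≤ f.totalDegree := le_totalDegree hα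
  apply isHomogeneous_monomial
  rw [map_add, Finsupp.degree_mapDomain, Finsupp.degree_single]
  have : α.degree = α.sum fun _ e => e := rfl
  omega

lemma homog_ne_zero {n : ℕ} {f : MvPolynomial (Fin n) ℝ} (hf : f ≠ 0) : homog f ≠ 0 := by
  intro h
  apply hf
  apply MvPolynomial.funext
  intro x
  have := eval_homog f (Fin.cons 1 x) (by simp)
  rw [h] at this
  simpa using this.symm

lemma homog_zero {n : ℕ} : homog (0 : MvPolynomial (Fin n) ℝ) = 0 := by
  simp [homog]

lemma homog_totalDegree {n : ℕ} {f : MvPolynomial (Fin n) ℝ} (hf : f ≠ 0) :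
    (homog f).totalDegree = f.totalDegree :=
  (homog_isHomogeneous f).totalDegree (homog_ne_zero hf)

open MonomialOrder in
lemma lc_add {m : ℕ} (p q : MvPolynomial (Fin m) ℝ)
    (hp : 0 ≤ degLex.leadingCoeff p) (hq : 0 ≤ degLex.leadingCoeff q) :
    0 ≤ degLex.leadingCoeff (p + q) ∧ p.totalDegree ≤ (p + q).totalDegree ∧
      q.totalDegree ≤ (p + q).totalDegree ∧ (p + q = 0 → p = 0 ∧ q = 0) := by
  by_cases hp0 : p = 0
  · subst hp0; simpa using hq
  by_cases hq0 : q = 0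
  · subst hq0; simpa using hp
  have hp' : 0 < degLex.leadingCoeff p := lt_of_le_of_ne hp (by simpa [eq_comm] using hp0)
  have hq' : 0 < degLex.leadingCoeff q := lt_of_le_of_ne hq (by simpa [eq_comm] using hq0)
  have key : 0 < degLex.leadingCoeff (p + q) ∧ p.totalDegree ≤ (p + q).totalDegree ∧
      q.totalDegree ≤ (p + q).totalDegree := by
    rcases lt_trichotomy (degLex.toSyn (degLex.degree p)) (degLex.toSyn (degLex.degree q))
      with h | h | h
    · have h1 := degLex.leadingCoeff_add_of_lt h
      have h2 := degLex.degree_add_of_lt h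
      rw [add_comm] at h1 h2
      refine ⟨by rwa [h1], degLex_totalDegree_monotone ?_, degLex_totalDegree_monotone ?_⟩
      · rw [h2]; exact h.le
      · rw [h2]
    · have h' := degLex.toSyn.injective h
      have hc : 0 < coeff (degLex.degree p) (p + q) := by
        rw [coeff_add]
        have : coeff (degLex.degree p) q = degLex.leadingCoeff q := by
          rw [h']; rfl
        rw [this]
        exact add_pos hp' hq'
      have hle := degLex.le_degree (mem_support_iff.mpr hc.ne')
      have hge := degLex.degree_add_le (f := p) (g := q)
      rw [h, sup_idem, ← h] at hge
      have heq := degLex.toSyn.injective (le_antisymm hge hle)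
      refine ⟨?_, degLex_totalDegree_monotone hle, degLex_totalDegree_monotone (h ▸ hle)⟩
      rw [leadingCoeff, heq]; exact hc
    · have h1 := degLex.leadingCoeff_add_of_lt h
      have h2 := degLex.degree_add_of_lt h
      refine ⟨by rwa [h1], degLex_totalDegree_monotone ?_, degLex_totalDegree_monotone ?_⟩
      · rw [h2]
      · rw [h2]; exact h.le
  refine ⟨key.1.le, key.2.1, key.2.2, fun h0 => ?_⟩
  rw [h0] at key
  simp at key

lemma lc_mul_self {m : ℕ} (a : MvPolynomial (Fin m) ℝ) :
    0 ≤ MonomialOrder.degLex.leadingCoeff (a * a) := by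
  rw [MonomialOrder.leadingCoeff_mul]; exact mul_self_nonneg _

lemma lc_sumSq {m : ℕ} {s : MvPolynomial (Fin m) ℝ} (hs : IsSumSq s) :
    0 ≤ MonomialOrder.degLex.leadingCoeff s := by
  induction hs with
  | zero => simp
  | sq_add a hs ih => exact (lc_add _ _ (lc_mul_self a) ih).1

lemma sumSq_nonneg {m : ℕ} (L : MvPolynomial (Fin m) ℝ →ₗ[ℝ] ℝ) (k : ℕ)
    (h : MvPolynomial (Fin m) ℝ) (hh : h ≠ 0)
    (hL : ∀ q, q ≠ 0 → 2 * q.totalDegree + h.totalDegree ≤ 2 * k → 0 ≤ L (h * q ^ 2))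
    {s : MvPolynomial (Fin m) ℝ} (hs : IsSumSq s) (hd : (s * h).totalDegree ≤ 2 * k) :
    0 ≤ L (s * h) := by
  induction hs with
  | zero => simp
  | @sq_add a s hs ih =>
    obtain ⟨-, h1, h2, h3⟩ := lc_add _ _ (lc_mul_self a) (lc_sumSq hs)
    by_cases h0 : a * a + s = 0
    · rw [h0]; simp
    rw [totalDegree_mul_of_isDomain h0 hh] at hd
    rw [add_mul, map_add]
    apply add_nonneg
    · by_cases ha : a = 0
      · simp [ha]
      rw [totalDegree_mul_of_isDomain ha ha] at h1
      have := hL a ha (by omega)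
      rwa [show a * a * h = h * a ^ 2 by ring]
    · apply ih
      by_cases hs0 : s = 0
      · simp [hs0]
      rw [totalDegree_mul_of_isDomain hs0 hh]
      omega

lemma sphere_totalDegree (n : ℕ) :
    2 ≤ ((∑ i : Fin (n + 1), X i ^ 2) - 1 : MvPolynomial (Fin (n + 1)) ℝ).totalDegree := by
  have hc : coeff (Finsupp.single 0 2)
      ((∑ i : Fin (n + 1), X i ^ 2) - 1 : MvPolynomial (Fin (n + 1)) ℝ) = 1 := by
    rw [coeff_sub, coeff_sum, Finset.sum_eq_single 0]
    · rw [coeff_X_pow, coeff_one]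
      have h0 : (0 : Fin (n + 1) →₀ ℕ) ≠ Finsupp.single 0 2 := by
        intro h
        have := DFunLike.congr_fun h 0
        simp at this
      simp [h0]
    · intro i _ hi
      rw [coeff_X_pow, if_neg]
      intro h
      have := DFunLike.congr_fun h i
      simp [hi.symm] at this
    · simp
  have := le_totalDegree (mem_support_iff.mpr (by rw [hc]; exact one_ne_zero) :
    Finsupp.single 0 2 ∈ ((∑ i : Fin (n + 1), X i ^ 2) - 1 : MvPolynomial (Fin (n + 1)) ℝ).support)
  simpa using this

lemma qmod_nonneg {n : ℕ} {ι : Type*} [Fintype ι] (k : ℕ) (g : ι → MvPolynomial (Fin n) ℝ)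
    (y : (Fin (n + 1) →₀ ℕ) → ℝ)
    (h1 : ∀ q : MvPolynomial (Fin (n + 1)) ℝ, q.totalDegree ≤ k → 0 ≤ riesz y (q ^ 2))
    (h2 : ∀ q : MvPolynomial (Fin (n + 1)) ℝ, q.totalDegree ≤ k - 1 → 0 ≤ riesz y (X 0 * q ^ 2))
    (h3 : ∀ q : MvPolynomial (Fin (n + 1)) ℝ, q.totalDegree ≤ 2 * (k - 1) →
        riesz y (((∑ i, X i ^ 2) - 1) * q) = 0)
    (h4 : ∀ j : ι, ∀ q : MvPolynomial (Fin (n + 1)) ℝ,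
        q.totalDegree ≤ k - ((g j).totalDegree + 1) / 2 → 0 ≤ riesz y (homog (g j) * q ^ 2))
    (p : MvPolynomial (Fin (n + 1)) ℝ) (hp : p ∈ QMod k (tGens g)) : 0 ≤ riesz y p := by
  obtain ⟨s₀, s, hs₀, hd₀, hs, rfl⟩ := hp
  rw [← rieszL_apply, map_add, map_sum]
  have hsph : ∀ σ : MvPolynomial (Fin (n + 1)) ℝ,
      (σ * ((∑ i, X i ^ 2) - 1)).totalDegree ≤ 2 * k →
      rieszL y (σ * ((∑ i, X i ^ 2) - 1)) = 0 := by
    intro σ hσ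
    by_cases h0 : σ = 0
    · simp [h0]
    have hdeg := sphere_totalDegree n
    rw [totalDegree_mul_of_isDomain h0 (by intro h; rw [h] at hdeg; simp at hdeg)] at hσ
    rw [mul_comm, rieszL_apply]
    apply h3
    omega
  apply add_nonneg
  · have := sumSq_nonneg (rieszL y) k 1 one_ne_zero (fun q _ hq => by
      rw [one_mul, rieszL_apply]
      apply h1
      simp at hq
      omega) hs₀ (by simpa using hd₀)
    simpa using this
  · apply Finset.sum_nonneg
    rintro (j | j) -
    · by_cases hg : g j = 0
      · simp [tGens, hg, homog_zero]
      · apply sumSq_nonneg (rieszL y) k _ _ _ (hs _).1 (hs _).2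
        · exact homog_ne_zero hg
        · intro q _ hq
          apply h4
          have : (tGens g (Sum.inl j)).totalDegree = (g j).totalDegree := homog_totalDegree hg
          omega
    · fin_cases j
      · apply sumSq_nonneg (rieszL y) k _ _ _ (hs _).1 (hs _).2
        · exact X_ne_zero _
        · intro q _ hq
          apply h2
          simp [tGens] at hq
          omega
      · exact (hsph _ (hs (Sum.inr 1)).2).ge
      · have hd := (hs (Sum.inr 2)).2
        have e : s (Sum.inr 2) * tGens g (Sum.inr 2) =
          (- s (Sum.inr 2)) * ((∑ i, X i ^ 2) - 1) := by
          simp [tGens]; ring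
        change 0 ≤ rieszL y (s (Sum.inr 2) * tGens g (Sum.inr 2))
        rw [e] at hd ⊢
        exact (hsph _ hd).ge

lemma omega_convex {n : ℕ} {ι : Type*} [Fintype ι] (k : ℕ) (g : ι → MvPolynomial (Fin n) ℝ) :
    Convex ℝ (omegaRel k g) := by
  rintro x ⟨y, a1, a2, a3, a4, a5, a6⟩ x' ⟨y', b1, b2, b3, b4, b5, b6⟩ a b ha hb hab
  refine ⟨a • y + b • y', ?_, ?_, ?_, ?_, ?_, ?_⟩
  · rw [riesz_comb, a1, b1]; simpa using hab
  · intro i; rw [riesz_comb, a2, b2]; simp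
  · intro q hq; rw [riesz_comb]
    exact add_nonneg (mul_nonneg ha (a3 q hq)) (mul_nonneg hb (b3 q hq))
  · intro q hq; rw [riesz_comb]
    exact add_nonneg (mul_nonneg ha (a4 q hq)) (mul_nonneg hb (b4 q hq))
  · intro q hq; rw [riesz_comb, a5 q hq, b5 q hq]; simp
  · intro j q hq; rw [riesz_comb]
    exact add_nonneg (mul_nonneg ha (a6 j q hq)) (mul_nonneg hb (b6 j q hq))

lemma semiS_subset_omega {n : ℕ} {ι : Type*} [Fintype ι] (k : ℕ)
    (g : ι → MvPolynomial (Fin n) ℝ) : semiS g ⊆ omegaRel k g := by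
  intro x hx
  set r : ℝ := Real.sqrt (1 + ∑ i, x i ^ 2) with hr
  have hpos : 0 < 1 + ∑ i, x i ^ 2 := by
    have : 0 ≤ ∑ i, x i ^ 2 := Finset.sum_nonneg fun i _ => sq_nonneg _
    linarith
  have hr0 : 0 < r := Real.sqrt_pos.mpr hpos
  have hr2 : r ^ 2 = 1 + ∑ i, x i ^ 2 := Real.sq_sqrt hpos.le
  set u : Fin (n + 1) → ℝ := Fin.cons (1 / r) (fun i => x i / r) with hu
  have hu0 : u 0 = 1 / r := rfl
  have hus : ∀ i : Fin n, u i.succ = x i / r := fun i => rfl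
  have hu0' : 0 < u 0 := by rw [hu0]; positivity
  refine ⟨fun α => r * ∏ i, u i ^ α i, ?_, ?_, ?_, ?_, ?_, ?_⟩
  · rw [riesz_point, eval_X, hu0]; field_simp
  · intro i; rw [riesz_point, eval_X, hus]; field_simp
  · intro q _; rw [riesz_point, map_pow]; positivity
  · intro q _; rw [riesz_point, map_mul, map_pow, eval_X]; positivity
  · intro q _
    rw [riesz_point, map_mul]
    have : eval u ((∑ i, X i ^ 2) - 1) = 0 := by
      simp only [map_sub, map_sum, map_pow, eval_X, map_one]
      rw [Fin.sum_univ_succ, hu0]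
      simp only [hus, div_pow]
      rw [← Finset.sum_div, hr2]
      field_simp
      simp
    rw [this]; simp
  · intro j q _
    rw [riesz_point, map_mul, map_pow, eval_homog _ _ hu0']
    have : (fun i => u (Fin.succ i) / u 0) = x := by
      funext i; rw [hus, hu0]; field_simp
    rw [this]
    have := hx j
    positivity

lemma omega_subset {n m : ℕ} {ι : Type*} [Fintype ι] (g : Fin m → MvPolynomial (Fin n) ℝ)
    (G : ι → MvPolynomial (Fin n) ℝ) (hsub : StS G ⊆ StC g)
    (hclosedinf : closure (StO g) = StC g) (k : ℕ) (hPP : ppBDR k G (StS G)) :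
    omegaRel k G ⊆ closure (convexHull ℝ (semiS g)) := by
  rintro x ⟨y, a1, a2, a3, a4, a5, a6⟩
  by_contra hx
  obtain ⟨f, u, hfx, hfS⟩ := geometric_hahn_banach_point_closed
    (convex_convexHull ℝ (semiS g)).closure isClosed_closure hx
  -- coefficients of `f`
  set a : Fin n → ℝ := fun i => f (Pi.single i 1) with ha
  have hf : ∀ z, f z = ∑ i, a i * z i := by
    intro z
    conv_lhs => rw [← Finset.univ_sum_single z]
    rw [map_sum]
    apply Finset.sum_congr rfl
    intro i _
    have : Pi.single i (z i) = z i • (Pi.single i 1 : Fin n → ℝ) := by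
      rw [← Pi.single_smul]; simp
    rw [this, map_smul, smul_eq_mul, mul_comm]
  have hC : ∀ z ∈ StC g, 0 ≤ -u * z 0 + ∑ i : Fin n, a i * z i.succ := by
    rw [← hclosedinf]
    change closure (StO g) ⊆ {z | 0 ≤ -u * z 0 + ∑ i : Fin n, a i * z i.succ}
    apply closure_minimal
    · rintro z ⟨hz, hz0⟩
      have hmem : (fun i : Fin n => z i.succ / z 0) ∈ semiS g := by
        intro j
        have := hz j
        rw [eval_homog _ _ hz0] at this
        exact nonneg_of_mul_nonneg_right this (by positivity)
      have h := hfS _ (subset_closure (subset_convexHull ℝ _ hmem))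
      rw [hf] at h
      have e : ∑ i : Fin n, a i * z i.succ = z 0 * ∑ i, a i * (z i.succ / z 0) := by
        rw [Finset.mul_sum]
        exact Finset.sum_congr rfl fun i _ => by field_simp
      rw [Set.mem_setOf_eq, e]
      nlinarith
    · exact isClosed_le continuous_const (by fun_prop)
  -- the linear functional on coefficients
  let F : (Fin (n + 2) → ℝ) → ℝ := fun c =>
    c 0 * riesz y 1 + ∑ i : Fin (n + 1), c i.succ * riesz y (X i)
  have hFcont : Continuous F := by fun_prop
  have hF : ∀ c, F c = riesz y (C (c 0) + ∑ i : Fin (n + 1), C (c i.succ) * X i) := by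
    intro c
    have e : (C (c 0) + ∑ i : Fin (n + 1), C (c i.succ) * X i : MvPolynomial (Fin (n + 1)) ℝ) =
        c 0 • 1 + ∑ i : Fin (n + 1), c i.succ • X i := by
      simp [smul_eq_C_mul]
    rw [e, ← rieszL_apply, map_add, map_sum]
    simp only [map_smul, smul_eq_mul]
    rfl
  let cc : ℝ → Fin (n + 2) → ℝ := fun ε => Fin.cons ε (Fin.cons (-u) a)
  have hFcc : ∀ ε, F (cc ε) = ε * riesz y 1 + (f x - u) := by
    intro ε
    simp only [F, cc, Fin.cons_zero, Fin.cons_succ]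
    rw [Fin.sum_univ_succ, hf]
    simp only [Fin.cons_zero, Fin.cons_succ, a1, a2]
    ring
  obtain ⟨ε, hε, hFε⟩ : ∃ ε > 0, F (cc ε) < 0 := by
    refine ⟨(u - f x) / (2 * (|riesz y 1| + 1)), ?_, ?_⟩
    · have : 0 < u - f x := by linarith
      positivity
    · rw [hFcc]
      have h1 : 0 < u - f x := by linarith
      have h2 : (u - f x) / (2 * (|riesz y 1| + 1)) * riesz y 1 ≤ (u - f x) / 2 := by
        rw [div_mul_eq_mul_div, div_le_div_iff₀ (by positivity) (by norm_num)]
        nlinarith [le_abs_self (riesz y 1)]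
      linarith
  set δ : ℝ := ε / (n + 2) with hδ
  have hδ0 : 0 < δ := by positivity
  let U : Set (Fin (n + 2) → ℝ) := Metric.ball (cc ε) δ ∩ {c | F c < 0}
  have hUo : IsOpen U := Metric.isOpen_ball.inter (isOpen_lt hFcont continuous_const)
  have hUn : U.Nonempty := ⟨cc ε, Metric.mem_ball_self hδ0, hFε⟩
  have hpos := hUo.measure_pos MeasureTheory.volume hUn
  apply hpos.ne'
  refine MeasureTheory.measure_mono_null ?_ hPP
  rintro c ⟨hcb, hcF⟩
  refine ⟨?_, fun hQ => ?_⟩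
  · intro z hz
    have hzC := hC z (hsub hz)
    have hz1 : ∀ i, |z i| ≤ 1 := by
      intro i
      rw [← sq_le_one_iff_abs_le_one, ← hz.2.2]
      exact Finset.single_le_sum (f := fun i => z i ^ 2) (fun i _ => sq_nonneg _)
        (Finset.mem_univ i)
    have hci : ∀ i, |c i - cc ε i| < δ := by
      intro i
      have := (dist_pi_lt_iff hδ0).mp (Metric.mem_ball.mp hcb) i
      rwa [Real.dist_eq] at this
    have h0 : ε - δ < c 0 := by
      have := (abs_lt.mp (hci 0)).1
      simp only [cc, Fin.cons_zero] at this
      linarith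
    have hi : ∀ i : Fin (n + 1), cc ε i.succ * z i - δ ≤ c i.succ * z i := by
      intro i
      have h := abs_mul (c i.succ - cc ε i.succ) (z i)
      have h2 : |(c i.succ - cc ε i.succ) * z i| ≤ δ := by
        rw [h]
        calc _ ≤ δ * 1 := mul_le_mul (hci _).le (hz1 i) (abs_nonneg _) hδ0.le
          _ = δ := mul_one _
      have := (abs_le.mp h2).1
      linarith
    have hsum := Finset.sum_le_sum fun i (_ : i ∈ Finset.univ) => hi i
    rw [Finset.sum_sub_distrib] at hsum
    have e : ∑ i : Fin (n + 1), cc ε i.succ * z i = -u * z 0 + ∑ i : Fin n, a i * z i.succ := by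
      rw [Fin.sum_univ_succ]; simp [cc]
    rw [e] at hsum
    simp at hsum
    have hδe : (n + 2) * δ = ε := by rw [hδ]; field_simp
    nlinarith
  · have := qmod_nonneg k G y a3 a4 a5 a6 _ hQ
    rw [← hF] at this
    exact absurd hcF (not_lt.mpr this)

end Stmt16Aux

/-- (Inclusions (4.2) in the proof of Theorem 4.3.) If `S` is closed at infinity and PP-BDR
holds with common order `k'` for every `S̃_e`, then for every `e ∈ {0,1}ⁿ`,
`closure (conv S_e) ⊆ closure (Ω_{k'}(G̃_e)) ⊆ closure (conv S)`. -/
theorem stmt16 (n m : ℕ) (g : Fin m → MvPolynomial (Fin n) ℝ)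
    (hclosedinf : closure (StO g) = StC g) (k' : ℕ)
    (hPP : ∀ e : Fin n → Fin 2,
      ppBDR k' (Sum.elim g fun j : Fin n =>
          (-1 : MvPolynomial (Fin n) ℝ) ^ (e j : ℕ) * X j)
        (StS (Sum.elim g fun j : Fin n =>
          (-1 : MvPolynomial (Fin n) ℝ) ^ (e j : ℕ) * X j))) :
    ∀ e : Fin n → Fin 2,
      closure (convexHull ℝ (semiS (Sum.elim g fun j : Fin n =>
          (-1 : MvPolynomial (Fin n) ℝ) ^ (e j : ℕ) * X j))) ⊆
        closure (omegaRel k' (Sum.elim g fun j : Fin n =>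
          (-1 : MvPolynomial (Fin n) ℝ) ^ (e j : ℕ) * X j)) ∧
      closure (omegaRel k' (Sum.elim g fun j : Fin n =>
          (-1 : MvPolynomial (Fin n) ℝ) ^ (e j : ℕ) * X j)) ⊆
        closure (convexHull ℝ (semiS g)) := by
  intro e
  constructor
  · exact closure_mono (convexHull_min (Stmt16Aux.semiS_subset_omega k' _)
      (Stmt16Aux.omega_convex k' _))
  · refine closure_minimal (Stmt16Aux.omega_subset g _ ?_ hclosedinf k' (hPP e)) isClosed_closure
    rintro z ⟨hz, hz0, -⟩
    exact ⟨fun j => hz (Sum.inl j), hz0⟩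
end

section
/- Let S := {(x₁,x₂) ∈ ℝ² : x₂ − x₁² ≥ 0} with the single generator g = X₂ − X₁², and let G̃ := {X₀, X₀X₂ − X₁², X₀²+X₁²+X₂²−1, 1−X₀²−X₁²−X₂²}. Then: (i) conv(closure(S̃ᵒ)) is closed and pointed, but S is not closed at ∞ (indeed S̃ᶜ \ closure(S̃ᵒ) = {(0,0,x₂) : x₂ < 0}); (ii) for every k ∈ ℕ, every homogeneous linear polynomial c₀X₀ + c₁X₁ + c₂X₂ belonging to Q_k(G̃) satisfies c₁ = c₂ = 0, and consequently TH̃_k(G̃) = ℝ² for every k, so ⋂_k TH̃_k(G̃) = ℝ² ≠ closure(conv(S)) = S. -/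
open MvPolynomial Pointwise

theorem aux_K_closure :
    closure {x : Fin 3 → ℝ | 0 ≤ x 0 * x 2 - x 1 ^ 2 ∧ 0 < x 0}
      = {x : Fin 3 → ℝ | 0 ≤ x 0 * x 2 - x 1 ^ 2 ∧ 0 ≤ x 0 ∧ 0 ≤ x 2} := by
  apply Set.Subset.antisymm
  · apply closure_minimal
    · rintro x ⟨h1, h2⟩
      refine ⟨h1, h2.le, ?_⟩
      by_contra h
      push Not at h
      nlinarith [mul_pos h2 (neg_pos.2 h), sq_nonneg (x 1)]
    · have e : {x : Fin 3 → ℝ | 0 ≤ x 0 * x 2 - x 1 ^ 2 ∧ 0 ≤ x 0 ∧ 0 ≤ x 2}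
        = {x : Fin 3 → ℝ | 0 ≤ x 0 * x 2 - x 1 ^ 2} ∩ ({x | 0 ≤ x 0} ∩ {x | 0 ≤ x 2}) := rfl
      rw [e]
      refine IsClosed.inter (isClosed_le (by fun_prop) (by fun_prop))
        (IsClosed.inter (isClosed_le (by fun_prop) (by fun_prop))
          (isClosed_le (by fun_prop) (by fun_prop)))
  · rintro x ⟨h1, h2, h3⟩
    have hc : Continuous (fun t : ℝ => x + t • (![1, 0, 1] : Fin 3 → ℝ)) := by fun_prop
    have ht : Filter.Tendsto (fun t : ℝ => x + t • (![1, 0, 1] : Fin 3 → ℝ))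
        (nhdsWithin 0 (Set.Ioi 0)) (nhds x) := by
      have := (hc.tendsto 0).mono_left (nhdsWithin_le_nhds (s := Set.Ioi (0:ℝ)))
      simpa using this
    refine mem_closure_of_tendsto ht ?_
    filter_upwards [self_mem_nhdsWithin] with t ht
    have ht : 0 < t := ht
    simp only [Set.mem_ofPred_eq, Pi.add_apply, Pi.smul_apply, smul_eq_mul]
    simp
    constructor <;> nlinarith [mul_nonneg ht.le h2, mul_nonneg ht.le h3]

theorem aux_K_convex :
    Convex ℝ {x : Fin 3 → ℝ | 0 ≤ x 0 * x 2 - x 1 ^ 2 ∧ 0 ≤ x 0 ∧ 0 ≤ x 2} := by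
  rintro x ⟨h1, h2, h3⟩ y ⟨k1, k2, k3⟩ a b ha hb _
  have key : 2 * (x 1 * y 1) ≤ x 0 * y 2 + x 2 * y 0 := by
    have hp : 0 ≤ x 0 * y 2 + x 2 * y 0 := by positivity
    apply le_of_sq_le_sq ?_ hp
    have : (x 1) ^ 2 * (y 1) ^ 2 ≤ (x 0 * x 2) * (y 0 * y 2) := by
      apply mul_le_mul <;> first | linarith | positivity
    nlinarith [sq_nonneg (x 0 * y 2 - x 2 * y 0)]
  simp only [Set.mem_ofPred_eq, Pi.add_apply, Pi.smul_apply, smul_eq_mul]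
  refine ⟨?_, by positivity, by positivity⟩
  nlinarith [mul_nonneg (mul_nonneg ha hb) (sub_nonneg.2 key), mul_nonneg (mul_nonneg ha ha) h1,
    mul_nonneg (mul_nonneg hb hb) k1]

theorem aux_S_closure : closure (convexHull ℝ {x : Fin 2 → ℝ | 0 ≤ x 1 - x 0 ^ 2})
    = {x : Fin 2 → ℝ | 0 ≤ x 1 - x 0 ^ 2} := by
  have hc : Convex ℝ {x : Fin 2 → ℝ | 0 ≤ x 1 - x 0 ^ 2} := by
    intro x hx y hy a b ha hb hab
    simp only [Set.mem_ofPred_eq, Pi.add_apply, Pi.smul_apply, smul_eq_mul] at *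
    obtain rfl : b = 1 - a := by linarith
    nlinarith [mul_nonneg (mul_nonneg ha hb) (sq_nonneg (x 0 - y 0)), mul_nonneg ha hx,
      mul_nonneg hb hy]
  rw [hc.convexHull_eq]
  exact IsClosed.closure_eq (isClosed_le (by fun_prop) (by fun_prop))

theorem aux_sumSq_eval {p : MvPolynomial (Fin 3) ℝ} (hp : IsSumSq p) (x : Fin 3 → ℝ) :
    0 ≤ eval x p := by
  induction hp with
  | zero => simp
  | sq_add a _ ih => simp only [map_add, map_mul]; nlinarith [mul_self_nonneg (eval x a)]

theorem aux_nonneg {k : ℕ} {p : MvPolynomial (Fin 3) ℝ}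
    (hp : p ∈ QMod k (![X 0, X 0 * X 2 - X 1 ^ 2, X 0 ^ 2 + X 1 ^ 2 + X 2 ^ 2 - 1,
        1 - (X 0 ^ 2 + X 1 ^ 2 + X 2 ^ 2)] : Fin 4 → MvPolynomial (Fin 3) ℝ))
    (x : Fin 3 → ℝ) (h0 : 0 ≤ x 0) (h1 : 0 ≤ x 0 * x 2 - x 1 ^ 2)
    (h2 : x 0 ^ 2 + x 1 ^ 2 + x 2 ^ 2 = 1) : 0 ≤ eval x p := by
  obtain ⟨s₀, s, hs₀, -, hs, rfl⟩ := hp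
  have a0 := aux_sumSq_eval hs₀ x
  have b0 := aux_sumSq_eval (hs 0).1 x
  have b1 := aux_sumSq_eval (hs 1).1 x
  simp [Fin.sum_univ_four, h2]
  have := mul_nonneg b0 h0
  have := mul_nonneg b1 h1
  linarith

theorem aux_coeff {k : ℕ} {c₀ c₁ c₂ : ℝ}
    (hp : (C c₀ * X 0 + C c₁ * X 1 + C c₂ * X 2) ∈ QMod k (![X 0, X 0 * X 2 - X 1 ^ 2,
        X 0 ^ 2 + X 1 ^ 2 + X 2 ^ 2 - 1,
        1 - (X 0 ^ 2 + X 1 ^ 2 + X 2 ^ 2)] : Fin 4 → MvPolynomial (Fin 3) ℝ)) :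
    0 ≤ c₀ ∧ c₁ = 0 ∧ c₂ = 0 := by
  have hneg : 0 ≤ -c₂ := by
    have := aux_nonneg hp ![0, 0, -1] (by simp) (by simp) (by simp)
    simpa using this
  have hpos : ∀ t : ℝ, 0 ≤ c₀ * t ^ 2 + c₁ * t + c₂ := by
    intro t
    have hN : 0 < t ^ 4 + t ^ 2 + 1 := by positivity
    set r := (Real.sqrt (t ^ 4 + t ^ 2 + 1))⁻¹ with hr
    have hr0 : 0 < r := by positivity
    have hr2 : r ^ 2 * (t ^ 4 + t ^ 2 + 1) = 1 := by
      rw [hr, inv_pow, Real.sq_sqrt hN.le]; field_simp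
    have := aux_nonneg hp ![r * t ^ 2, r * t, r] (by simp; positivity)
      (by simp; apply le_of_eq; ring) (by simp; linear_combination hr2)
    simp at this
    have h : 0 ≤ r * (c₀ * t ^ 2 + c₁ * t + c₂) := by linarith
    exact nonneg_of_mul_nonneg_right h hr0
  have h2 : c₂ = 0 := by have := hpos 0; simp at this; linarith
  subst h2
  have h0 : 0 ≤ c₀ := by linarith [hpos 1, hpos (-1)]
  refine ⟨h0, ?_, rfl⟩
  have h := hpos (-c₁ / (c₀ + 1))
  have e : c₀ * (-c₁ / (c₀ + 1)) ^ 2 + c₁ * (-c₁ / (c₀ + 1)) + 0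
      = - (c₁ ^ 2 / (c₀ + 1) ^ 2) := by field_simp; ring
  rw [e] at h
  have h' : c₁ ^ 2 / (c₀ + 1) ^ 2 = 0 := le_antisymm (by linarith) (by positivity)
  rw [div_eq_zero_iff] at h'
  rcases h' with h' | h'
  · exact pow_eq_zero_iff (two_ne_zero) |>.1 h'
  · nlinarith

theorem aux_linear {l : MvPolynomial (Fin 3) ℝ} (hl : l.IsHomogeneous 1) :
    ∃ c₀ c₁ c₂ : ℝ, l = C c₀ * X 0 + C c₁ * X 1 + C c₂ * X 2 := by
  have h : l ∈ homogeneousSubmodule (Fin 3) ℝ 1 := hl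
  rw [homogeneousSubmodule_one_eq_span_X, Submodule.mem_span_range_iff_exists_fun] at h
  obtain ⟨c, rfl⟩ := h
  exact ⟨c 0, c 1, c 2, by simp [Fin.sum_univ_three, smul_eq_C_mul]⟩

/-- Example 3.7: for `S = {x : x₂ - x₁² ≥ 0}` with
`G̃ = {X₀, X₀X₂ - X₁², X₀²+X₁²+X₂²-1, 1-X₀²-X₁²-X₂²}`: (i) `conv (closure S̃ᵒ)` is closed
and pointed but `S` is not closed at infinity
(`S̃ᶜ \ closure S̃ᵒ = {(0,0,x₂) : x₂ < 0}`); (ii) every homogeneous linear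
`c₀X₀ + c₁X₁ + c₂X₂` in `Q_k(G̃)` has `c₁ = c₂ = 0`, hence `TH̃_k(G̃) = ℝ²` for every `k`
and `⋂ₖ TH̃_k(G̃) = ℝ² ≠ closure (conv S) = S`. -/
theorem stmt17 :
    letI Gt : Fin 4 → MvPolynomial (Fin 3) ℝ :=
      ![X 0, X 0 * X 2 - X 1 ^ 2, X 0 ^ 2 + X 1 ^ 2 + X 2 ^ 2 - 1,
        1 - (X 0 ^ 2 + X 1 ^ 2 + X 2 ^ 2)]
    letI S : Set (Fin 2 → ℝ) := {x | 0 ≤ x 1 - x 0 ^ 2}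
    letI StO : Set (Fin 3 → ℝ) := {x | 0 ≤ x 0 * x 2 - x 1 ^ 2 ∧ 0 < x 0}
    letI StC : Set (Fin 3 → ℝ) := {x | 0 ≤ x 0 * x 2 - x 1 ^ 2 ∧ 0 ≤ x 0}
    letI TH : ℕ → Set (Fin 2 → ℝ) := fun k =>
      {x | ∀ l ∈ QMod k Gt, l.IsHomogeneous 1 → 0 ≤ eval (Fin.cons 1 x) l}
    (IsClosed (convexHull ℝ (closure StO)) ∧
      convexHull ℝ (closure StO) ∩ -(convexHull ℝ (closure StO)) = {0}) ∧
    (StC \ closure StO = {x : Fin 3 → ℝ | x 0 = 0 ∧ x 1 = 0 ∧ x 2 < 0}) ∧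
    closure StO ≠ StC ∧
    (∀ k : ℕ, ∀ c₀ c₁ c₂ : ℝ,
      (C c₀ * X 0 + C c₁ * X 1 + C c₂ * X 2) ∈ QMod k Gt → c₁ = 0 ∧ c₂ = 0) ∧
    (∀ k : ℕ, TH k = Set.univ) ∧
    (⋂ k : ℕ, TH (k + 1)) = Set.univ ∧
    closure (convexHull ℝ S) = S ∧
    (⋂ k : ℕ, TH (k + 1)) ≠ closure (convexHull ℝ S) := by
  let S : Set (Fin 2 → ℝ) := {x | 0 ≤ x 1 - x 0 ^ 2}
  let StO : Set (Fin 3 → ℝ) := {x | 0 ≤ x 0 * x 2 - x 1 ^ 2 ∧ 0 < x 0}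
  let StC : Set (Fin 3 → ℝ) := {x | 0 ≤ x 0 * x 2 - x 1 ^ 2 ∧ 0 ≤ x 0}
  let TH : ℕ → Set (Fin 2 → ℝ) := fun k =>
    {x | ∀ l ∈ QMod k (![X 0, X 0 * X 2 - X 1 ^ 2, X 0 ^ 2 + X 1 ^ 2 + X 2 ^ 2 - 1,
        1 - (X 0 ^ 2 + X 1 ^ 2 + X 2 ^ 2)] : Fin 4 → MvPolynomial (Fin 3) ℝ),
      l.IsHomogeneous 1 → 0 ≤ eval (Fin.cons 1 x) l}
  have hcl : closure StO = {x : Fin 3 → ℝ | 0 ≤ x 0 * x 2 - x 1 ^ 2 ∧ 0 ≤ x 0 ∧ 0 ≤ x 2} :=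
    aux_K_closure
  have hhull : convexHull ℝ (closure StO) = closure StO := by
    apply Convex.convexHull_eq
    rw [hcl]
    exact aux_K_convex
  have hdiff : StC \ closure StO = {x : Fin 3 → ℝ | x 0 = 0 ∧ x 1 = 0 ∧ x 2 < 0} := by
    rw [hcl]
    ext x
    constructor
    · rintro ⟨⟨h1, h2⟩, h3⟩
      have h4 : x 2 < 0 := by
        by_contra h
        exact h3 ⟨h1, h2, not_lt.1 h⟩
      have h5 : x 1 ^ 2 = 0 := by nlinarith [mul_nonneg h2 (neg_nonneg.2 h4.le), sq_nonneg (x 1)]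
      refine ⟨?_, by simpa using h5, h4⟩
      nlinarith
    · rintro ⟨h1, h2, h3⟩
      refine ⟨⟨by simp [h1, h2], h1.ge⟩, ?_⟩
      rintro ⟨-, -, h⟩
      exact absurd h (not_le.2 h3)
  have hTH : ∀ k, TH k = Set.univ := by
    intro k
    rw [Set.eq_univ_iff_forall]
    intro x l hl hh
    obtain ⟨c₀, c₁, c₂, rfl⟩ := aux_linear hh
    obtain ⟨h0, rfl, rfl⟩ := aux_coeff hl
    simpa using h0
  have hI : (⋂ k : ℕ, TH (k + 1)) = Set.univ := by simp [hTH]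
  have hS : closure (convexHull ℝ S) = S := aux_S_closure
  refine ⟨⟨(?_ : IsClosed (convexHull ℝ (closure StO))),
    (?_ : convexHull ℝ (closure StO) ∩ -(convexHull ℝ (closure StO)) = {0})⟩, hdiff,
    (?_ : closure StO ≠ StC), ?_, hTH, hI, hS,
    (?_ : (⋂ k : ℕ, TH (k + 1)) ≠ closure (convexHull ℝ S))⟩
  · rw [hhull]; exact isClosed_closure
  · rw [hhull, hcl]
    ext x
    constructor
    · rintro ⟨⟨h1, h2, h3⟩, ⟨-, k2, k3⟩⟩
      simp only [Pi.neg_apply] at k2 k3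
      have e0 : x 0 = 0 := by linarith
      have e2 : x 2 = 0 := by linarith
      have e1 : x 1 = 0 := by
        rw [e0] at h1
        have : x 1 ^ 2 = 0 := by nlinarith [sq_nonneg (x 1)]
        simpa using this
      rw [Set.mem_singleton_iff]
      funext i
      fin_cases i <;> simp [e0, e1, e2]
    · rintro rfl
      simp
  · intro h
    have : (![0, 0, -1] : Fin 3 → ℝ) ∈ StC \ closure StO := by
      rw [hdiff]; simp
    rw [h] at this
    simp at this
  · intro k c₀ c₁ c₂ h
    exact (aux_coeff h).2
  · rw [hI, hS]
    intro h
    have : (![0, -1] : Fin 2 → ℝ) ∈ S := h ▸ Set.mem_univ _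
    have h' : (0:ℝ) ≤ (![0, -1] : Fin 2 → ℝ) 1 - (![0, -1] : Fin 2 → ℝ) 0 ^ 2 := this
    norm_num at h'
end
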